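/- Positive renormalisation of weakly homogeneous germs: let F be a weakly ᾱ-homogeneous germ of order r ∈ ℕ₀. Then all pointwise derivatives D^k F_x(x), x ∈ ℝ^d, 0 ≤ |k| < ᾱ, exist, and for every compact K and λ̄ > 0, sup_{x∈K} |D^k F_x(x)| ≤ cst · (weak ᾱ-homogeneity seminorm of F on (K,λ̄) at order r), with cst depending only on ᾱ, λ̄, r, d. Define G_x := F_x − Σ_{0≤|k|<ᾱ} D^k F_x(x)(·−x)^k/k!. Then: (1) if ᾱ ∉ ℕ₀, G is ᾱ-homogeneous, and for all K, λ̄, r the ᾱ-homogeneity seminorm of G on (K,λ̄) at order r is ≤ cst' times the weak ᾱ-homogeneity seminorm of F on (K,λ̄) at order r, with cst' depending only on ᾱ, r, d; (2) if ᾱ ∈ ℕ₀ and in addition each germ D^k F, |k| = ᾱ, is 0-homogeneous, the same conclusion holds with the sum of the 0-homogeneity seminorms of the D^k F, |k| = ᾱ, added on the right-hand side. -/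

import Mathlib

open MeasureTheory Metric Filter
open scoped Classical Pointwise Topology

noncomputable section

/-- Euclidean space `ℝ^d`. -/
abbrev Ed (d : ℕ) := EuclideanSpace ℝ (Fin d)

/-- Multi-indices `k ∈ ℕ₀^d`. -/
abbrev MIdx (d : ℕ) := Fin d → ℕ

variable {d : ℕ}

/-- Degree `|k|` of a multi-index. -/
def mdeg (k : MIdx d) : ℕ := ∑ i, k i

/-- Factorial `k!` of a multi-index. -/
def mfact (k : MIdx d) : ℕ := ∏ i, Nat.factorial (k i)

/-- Monomial `v^k`. -/
def mpow (v : Ed d) (k : MIdx d) : ℝ := ∏ i, (v i) ^ (k i)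

/-- Partial (line) derivative in coordinate `i`. -/
def pd (i : Fin d) (f : Ed d → ℝ) : Ed d → ℝ :=
  fun x => lineDeriv ℝ f x (EuclideanSpace.single i (1:ℝ))

/-- Iterated partial derivative `∂^k`. -/
def mderiv (k : MIdx d) (f : Ed d → ℝ) : Ed d → ℝ :=
  (List.finRange d).foldr (fun i g => (pd i)^[k i] g) f

/-- Smooth compactly supported test function. -/
def IsTest (φ : Ed d → ℝ) : Prop := ContDiff ℝ (⊤ : ℕ∞) φ ∧ HasCompactSupport φ

/-- The `C^r` norm `max_{|k| ≤ r} ‖∂^k φ‖_∞`. -/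
def crNorm (r : ℕ) (φ : Ed d → ℝ) : ℝ :=
  ⨆ k : {k : MIdx d // mdeg k ≤ r}, ⨆ x : Ed d, |mderiv k.1 φ x|

/-- Generalized functions: arbitrary functionals on functions on `ℝ^d`. -/
abbrev DFunc (d : ℕ) := (Ed d → ℝ) → ℝ

/-- `f` is a distribution in `𝒟'(ℝ^d)`: linear on test functions and,
on every compact, bounded by some `C^r` norm. -/
def IsDistribution (f : DFunc d) : Prop :=
  (∀ φ ψ : Ed d → ℝ, IsTest φ → IsTest ψ → f (φ + ψ) = f φ + f ψ) ∧
  (∀ (c : ℝ) (φ : Ed d → ℝ), IsTest φ → f (c • φ) = c * f φ) ∧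
  (∀ K : Set (Ed d), IsCompact K → ∃ (r : ℕ) (C : ℝ),
    ∀ φ : Ed d → ℝ, IsTest φ → tsupport φ ⊆ K → |f φ| ≤ C * crNorm r φ)

/-- `f` is a distribution of order `r` (bound by the `C^r` norm on every compact). -/
def DistOrder (f : DFunc d) (r : ℕ) : Prop :=
  ∀ K : Set (Ed d), IsCompact K → ∃ C : ℝ,
    ∀ φ : Ed d → ℝ, IsTest φ → tsupport φ ⊆ K → |f φ| ≤ C * crNorm r φ

/-- `φ` is of class `C^r`: all iterated coordinate-partials up to order `r`
exist and are continuous. -/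
def IsCr (r : ℕ) (φ : Ed d → ℝ) : Prop :=
  ∀ k : MIdx d, mdeg k ≤ r →
    Continuous (mderiv k φ) ∧
    (mdeg k < r → ∀ (i : Fin d) (x : Ed d),
      LineDifferentiableAt ℝ (mderiv k φ) x (EuclideanSpace.single i (1:ℝ)))

/-- The functional `f` acts canonically (linearly, with local order-`r` bounds) on all
compactly supported `C^r` functions; i.e. `f` incorporates the canonical extension of a
distribution of order `r`. -/
def OrderExt (f : DFunc d) (r : ℕ) : Prop :=
  (∀ φ ψ : Ed d → ℝ, IsCr r φ → HasCompactSupport φ → IsCr r ψ → HasCompactSupport ψ →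
      f (φ + ψ) = f φ + f ψ) ∧
  (∀ (c : ℝ) (φ : Ed d → ℝ), IsCr r φ → HasCompactSupport φ → f (c • φ) = c * f φ) ∧
  (∀ K : Set (Ed d), IsCompact K → ∃ C : ℝ,
    ∀ φ : Ed d → ℝ, IsCr r φ → HasCompactSupport φ → tsupport φ ⊆ K → |f φ| ≤ C * crNorm r φ)

/-- The scaled recentred test function `φ_x^λ(y) = λ^{-d} φ(λ^{-1}(y-x))`. -/
def scTF (φ : Ed d → ℝ) (x : Ed d) (l : ℝ) : Ed d → ℝ :=
  fun y => (l ^ d)⁻¹ * φ (l⁻¹ • (y - x))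

/-- The class `𝓑^r` of smooth test functions supported in the closed unit ball with
all derivatives of order `≤ r` bounded by one. -/
def TB (d r : ℕ) : Set (Ed d → ℝ) :=
  {φ | IsTest φ ∧ tsupport φ ⊆ closedBall (0 : Ed d) 1 ∧
    ∀ k : MIdx d, mdeg k ≤ r → ∀ x, |mderiv k φ x| ≤ 1}

/-- The class `𝓑_γ` of smooth test functions supported in the closed unit ball which
annihilate all monomials of degree `≤ γ`. -/
def TAnn (d : ℕ) (γ : ℝ) : Set (Ed d → ℝ) :=
  {φ | IsTest φ ∧ tsupport φ ⊆ closedBall (0 : Ed d) 1 ∧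
    ∀ k : MIdx d, (mdeg k : ℝ) ≤ γ → (∫ z, φ z * mpow z k) = 0}

/-- The class `𝓑^r_γ = 𝓑^r ∩ 𝓑_γ`. -/
def TBAnn (d r : ℕ) (γ : ℝ) : Set (Ed d → ℝ) := TB d r ∩ TAnn d γ

/-- A germ: a family of functionals indexed by base points. -/
abbrev GermF (d : ℕ) := Ed d → DFunc d

/-- A germ of distributions, measurable in the base point. -/
def IsGerm (F : GermF d) : Prop :=
  (∀ x, IsDistribution (F x)) ∧ ∀ φ : Ed d → ℝ, IsTest φ → Measurable (fun x => F x φ)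

/-- Homogeneity bound with constant `C`: `|F_x(φ_x^λ)| ≤ C λ^ᾱ` on `(K, λ̄)` at order `r`. -/
def HomB (F : GermF d) (a : ℝ) (r : ℕ) (K : Set (Ed d)) (lb C : ℝ) : Prop :=
  ∀ x ∈ K, ∀ l : ℝ, 0 < l → l ≤ lb → ∀ φ ∈ TB d r, |F x (scTF φ x l)| ≤ C * l ^ a

/-- Coherence bound with constant `C`:
`|(F_y - F_x)(φ_x^λ)| ≤ C λ^α (|y-x|+λ)^{γ-α}` on `(K, λ̄)` at order `r`. -/
def CohB (F : GermF d) (a g : ℝ) (r : ℕ) (K : Set (Ed d)) (lb C : ℝ) : Prop :=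
  ∀ x ∈ K, ∀ y ∈ K, ∀ l : ℝ, 0 < l → l ≤ lb → ∀ φ ∈ TB d r,
    |F y (scTF φ x l) - F x (scTF φ x l)| ≤ C * l ^ a * (dist y x + l) ^ (g - a)

/-- `F` is `ᾱ`-homogeneous of order `r`. -/
def Homog (F : GermF d) (a : ℝ) (r : ℕ) : Prop :=
  ∀ K : Set (Ed d), IsCompact K → ∀ lb : ℝ, 1 ≤ lb → ∃ C, HomB F a r K lb C

/-- `F` is `(α, γ)`-coherent of order `r`. -/
def Coh (F : GermF d) (a g : ℝ) (r : ℕ) : Prop :=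
  ∀ K : Set (Ed d), IsCompact K → ∀ lb : ℝ, 1 ≤ lb → ∃ C, CohB F a g r K lb C

/-- Weak homogeneity bound with constant `C` (test functions annihilating polynomials
at small scales, plus a scale-one bound on all of `𝓑^r`). -/
def WHomB (F : GermF d) (a : ℝ) (r : ℕ) (K : Set (Ed d)) (lb C : ℝ) : Prop :=
  (∀ x ∈ K, ∀ l : ℝ, 0 < l → l ≤ lb → ∀ φ ∈ TBAnn d r a,
      |F x (scTF φ x l)| ≤ C * l ^ a) ∧
  (∀ x ∈ K, ∀ ψ ∈ TB d r, |F x (scTF ψ x 1)| ≤ C)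

/-- Weak coherence bound with constant `C`. -/
def WCohB (F : GermF d) (a g : ℝ) (r : ℕ) (K : Set (Ed d)) (lb C : ℝ) : Prop :=
  (∀ x ∈ K, ∀ y ∈ K, ∀ l : ℝ, 0 < l → l ≤ lb → ∀ φ ∈ TBAnn d r g,
      |F y (scTF φ x l) - F x (scTF φ x l)| ≤ C * l ^ a * (dist y x + l) ^ (g - a)) ∧
  (∀ x ∈ K, ∀ y ∈ K, ∀ ψ ∈ TB d r, |F y (scTF ψ x 1) - F x (scTF ψ x 1)| ≤ C)

/-- `F` is weakly `ᾱ`-homogeneous of order `r`. -/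
def WHomog (F : GermF d) (a : ℝ) (r : ℕ) : Prop :=
  ∀ K : Set (Ed d), IsCompact K → ∀ lb : ℝ, 1 ≤ lb → ∃ C, WHomB F a r K lb C

/-- `F` is weakly `(α,γ)`-coherent of order `r`. -/
def WCoh (F : GermF d) (a g : ℝ) (r : ℕ) : Prop :=
  ∀ K : Set (Ed d), IsCompact K → ∀ lb : ℝ, 1 ≤ lb → ∃ C, WCohB F a g r K lb C

/-- The canonical order `r_{ᾱ,α} = min{n ∈ ℕ₀ : n > max(-ᾱ, -α)}`. -/
def rJ (a b : ℝ) : ℕ := (⌊max (-a) (-b)⌋ + 1).toNat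

/-- Joint homogeneity-and-coherence bound at the canonical order. -/
def JointB (F : GermF d) (ab a g : ℝ) (K : Set (Ed d)) (lb C : ℝ) : Prop :=
  HomB F ab (rJ ab a) K lb C ∧ CohB F a g (rJ ab a) K lb C

/-- Joint weak homogeneity-and-coherence bound at the canonical order. -/
def WJointB (F : GermF d) (ab a g : ℝ) (K : Set (Ed d)) (lb C : ℝ) : Prop :=
  WHomB F ab (rJ ab a) K lb C ∧ WCohB F a g (rJ ab a) K lb C

/-- `R` is a `γ`-reconstruction of the `(α,γ)`-coherent germ `F`. -/
def IsRec (F : GermF d) (R : DFunc d) (a g : ℝ) : Prop :=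
  ∀ r : ℕ, -a < (r : ℝ) → ∀ K : Set (Ed d), IsCompact K → ∃ C : ℝ,
    ∀ x ∈ K, ∀ l : ℝ, 0 < l → l ≤ 1 → ∀ φ ∈ TB d r,
      |F x (scTF φ x l) - R (scTF φ x l)| ≤ C * l ^ g

/-- Mixed partial derivative `∂_1^k ∂_2^l K(x,y)` of a kernel. -/
def mixDeriv (k l : MIdx d) (Kf : Ed d → Ed d → ℝ) (x y : Ed d) : ℝ :=
  mderiv k (fun x' => mderiv l (fun y' => Kf x' y') y) x

/-- The kernel `K(x,y)` is of class `C^{m,r}` (mixed partials `∂_1^k ∂_2^l`, `|k| ≤ m`,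
`|l| ≤ r`, exist and are continuous). -/
def IsCmr (m r : ℕ) (Kf : Ed d → Ed d → ℝ) : Prop :=
  ∀ k l : MIdx d, mdeg k ≤ m → mdeg l ≤ r →
    Continuous (fun p : Ed d × Ed d => mixDeriv k l Kf p.1 p.2) ∧
    (mdeg k < m → ∀ (i : Fin d) (x y : Ed d),
      LineDifferentiableAt ℝ (fun x' => mixDeriv k l Kf x' y) x
        (EuclideanSpace.single i (1:ℝ))) ∧
    (mdeg l < r → ∀ (j : Fin d) (x y : Ed d),
      LineDifferentiableAt ℝ (mderiv l (fun y' => Kf x y')) y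
        (EuclideanSpace.single j (1:ℝ)))

/-- `Kn` is the dyadic decomposition of a `β`-regularising kernel of order `(m,r)`
with range `ρ` (Definition 2.3 of the paper). -/
def RegKer (d : ℕ) (β : ℝ) (m r : ℕ) (ρ : ℝ) (Kn : ℕ → Ed d → Ed d → ℝ) : Prop :=
  (∀ n, IsCmr m r (Kn n)) ∧
  (∀ n x y, Kn n x y ≠ 0 → dist x y ≤ ρ * 2 ^ (-(n : ℝ))) ∧
  (∀ K : Set (Ed d), IsCompact K → ∃ c : ℝ, 0 < c ∧
    (∀ n, ∀ k l : MIdx d, mdeg k ≤ m → mdeg l ≤ r → ∀ x ∈ K, ∀ y ∈ K,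
      |mixDeriv k l (Kn n) x y| ≤
        c * 2 ^ ((((d : ℝ) - β + (mdeg l : ℝ) + (mdeg k : ℝ))) * n)) ∧
    (∀ n, ∀ k l : MIdx d, mdeg k ≤ r → mdeg l ≤ r → ∀ y ∈ K,
      |∫ x, mpow (y - x) l * mderiv k (fun y' => Kn n x y') y| ≤ c * 2 ^ (-(β * (n : ℝ)))))

/-- `K_n^* ψ (y) = ∫ ψ(x) K_n(x,y) dx`. -/
def kstar (Kf : Ed d → Ed d → ℝ) (ψ : Ed d → ℝ) : Ed d → ℝ :=
  fun y => ∫ x, ψ x * Kf x y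

/-- `g = 𝖪 f`, i.e. `g(ψ) = Σ_n f(K_n^* ψ)` (with convergence) on test functions. -/
def KInt (Kn : ℕ → Ed d → Ed d → ℝ) (f g : DFunc d) : Prop :=
  ∀ ψ : Ed d → ℝ, IsTest ψ → HasSum (fun n => f (kstar (Kn n) ψ)) (g ψ)

/-- The kernel decomposition preserves polynomials at level `γ`. -/
def PresPoly (Kn : ℕ → Ed d → Ed d → ℝ) (γ : ℝ) : Prop :=
  ∀ n, ∀ k : MIdx d, (mdeg k : ℝ) ≤ γ →
    ∃ p : MvPolynomial (Fin d) ℝ, p.totalDegree ≤ mdeg k ∧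
      ∀ x : Ed d, (∫ y, Kn n x y * mpow y k) = MvPolynomial.eval (fun i => x i) p

/-- Distributional derivative `D^k f (φ) = (-1)^{|k|} f(∂^k φ)`. -/
def distDeriv (k : MIdx d) (f : DFunc d) : DFunc d :=
  fun φ => (-1 : ℝ) ^ (mdeg k) * f (mderiv k φ)

/-- `η ∈ 𝒟` with `∫ η = 1` and vanishing moments of orders `1 ≤ |l| < δ`. -/
def GoodEta (δ : ℝ) (η : Ed d → ℝ) : Prop :=
  IsTest η ∧ (∫ z, η z) = 1 ∧
    ∀ k : MIdx d, 1 ≤ mdeg k → (mdeg k : ℝ) < δ → (∫ z, η z * mpow z k) = 0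

/-- `v` is the pointwise derivative `D^k f(x)`, defined through the limit
`lim_{λ↓0} D^k f(η_x^λ)` for every admissible mollifier `η`. -/
def HasPtDeriv (f : DFunc d) (δ : ℝ) (k : MIdx d) (x : Ed d) (v : ℝ) : Prop :=
  ∀ η : Ed d → ℝ, GoodEta δ η →
    Tendsto (fun l : ℝ => distDeriv k f (scTF η x l)) (nhdsWithin 0 (Set.Ioi 0)) (nhds v)

/-- The Taylor polynomial `Σ_{|k| < δ} c_k (·-x)^k / k!`, viewed as the functional
`ψ ↦ Σ_{|k| < δ} c_k ∫ ψ(y) (y-x)^k / k! dy`. -/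
def taylorF (δ : ℝ) (c : MIdx d → ℝ) (x : Ed d) : DFunc d :=
  fun ψ => ∑ᶠ k ∈ {k : MIdx d | (mdeg k : ℝ) < δ},
    c k * ((∫ y, ψ y * mpow (y - x) k) / (mfact k))

/-- The smallest positive integer `> -γ` (used in Hölder–Zygmund spaces for `γ < 0`). -/
def rNeg (γ : ℝ) : ℕ := (⌊-γ + 1⌋).toNat

/-- The Hölder–Zygmund bound with constant `C` on the compact `K` (with `λ̄ = 1`). -/
def ZBound (γ : ℝ) (f : DFunc d) (K : Set (Ed d)) (C : ℝ) : Prop :=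
  (γ < 0 → ∀ x ∈ K, ∀ l : ℝ, 0 < l → l ≤ 1 → ∀ φ ∈ TB d (rNeg γ),
    |f (scTF φ x l)| ≤ C * l ^ γ) ∧
  (0 ≤ γ →
    (∀ x ∈ K, ∀ ψ ∈ TB d 0, |f (scTF ψ x 1)| ≤ C) ∧
    (∀ x ∈ K, ∀ l : ℝ, 0 < l → l ≤ 1 → ∀ φ ∈ TBAnn d 0 γ,
      |f (scTF φ x l)| ≤ C * l ^ γ))

/-- Membership in the local Hölder–Zygmund space `𝒵^γ`. -/
def MemZ (γ : ℝ) (f : DFunc d) : Prop :=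
  IsDistribution f ∧ ∀ K : Set (Ed d), IsCompact K → ∃ C, ZBound γ f K C

/-- `(Pg, Gg)` is a model with homogeneities `α` of order `rP`, with index set `S`. -/
def IsModelOn {ι : Type} (S : Finset ι) (Pg : ι → GermF d)
    (Gg : ι → ι → Ed d → Ed d → ℝ) (α : ι → ℝ) (rP : ℕ) : Prop :=
  (∀ i ∈ S, IsGerm (Pg i)) ∧
  (∀ i ∈ S, Homog (Pg i) (α i) rP) ∧
  (∀ i ∈ S, ∀ x y : Ed d, ∀ φ : Ed d → ℝ, IsTest φ →
    Pg i y φ = ∑ j ∈ S, Pg j x φ * Gg j i x y)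

/-- The modelled-distribution bound with constant `C` on the compact `K`. -/
def MDB {ι : Type} (S : Finset ι) (Gg : ι → ι → Ed d → Ed d → ℝ) (α : ι → ℝ)
    (γ : ℝ) (f : Ed d → ι → ℝ) (K : Set (Ed d)) (C : ℝ) : Prop :=
  (∀ x ∈ K, ∀ i ∈ S, |f x i| ≤ C) ∧
  (∀ x ∈ K, ∀ y ∈ K, ∀ i ∈ S,
    |(∑ j ∈ S, Gg i j x y * f y j) - f x i| ≤ C * (dist y x) ^ (γ - α i))

/-- `f` is a modelled distribution of order `γ` relative to the model data. -/
def IsMD {ι : Type} (S : Finset ι) (Gg : ι → ι → Ed d → Ed d → ℝ) (α : ι → ℝ)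
    (γ : ℝ) (f : Ed d → ι → ℝ) : Prop :=
  (∀ i ∈ S, Measurable fun x : Ed d => f x i) ∧
  ∀ K : Set (Ed d), IsCompact K → ∃ C, MDB S Gg α γ f K C

/-- The germ `⟨f, Π⟩_x = Σ_i f^i(x) Π^i_x`. -/
def germOf {ι : Type} (S : Finset ι) (Pg : ι → GermF d) (f : Ed d → ι → ℝ) : GermF d :=
  fun x φ => ∑ i ∈ S, f x i * Pg i x φ

/-! ### Test functions -/

lemma IsTest.add {φ ψ : Ed d → ℝ} (h : IsTest φ) (h' : IsTest ψ) : IsTest (φ + ψ) :=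
  ⟨h.1.add h'.1, h.2.add h'.2⟩

lemma IsTest.smul {φ : Ed d → ℝ} (c : ℝ) (h : IsTest φ) : IsTest (c • φ) :=
  ⟨h.1.const_smul c, h.2.smul_left (f := fun _ => c)⟩

lemma isTest_zero : IsTest (0 : Ed d → ℝ) :=
  ⟨contDiff_const, HasCompactSupport.zero⟩

lemma isTest_sum {ι : Type*} (s : Finset ι) (f : ι → Ed d → ℝ) (h : ∀ i ∈ s, IsTest (f i)) :
    IsTest (∑ i ∈ s, f i) := by
  induction s using Finset.induction_on with
  | empty => simpa using isTest_zero
  | insert a s ha ih =>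
    rw [Finset.sum_insert ha]
    exact (h a (by simp)).add (ih fun i hi => h i (by simp [hi]))

lemma IsTest.diff {φ : Ed d → ℝ} (h : IsTest φ) : Differentiable ℝ φ :=
  h.1.differentiable (by simp)

lemma pd_eq {φ : Ed d → ℝ} (h : IsTest φ) (i : Fin d) :
    pd i φ = fun x => fderiv ℝ φ x (EuclideanSpace.single i (1:ℝ)) := by
  funext x
  exact (h.diff x).lineDeriv_eq_fderiv

lemma tsupport_pd {φ : Ed d → ℝ} (h : IsTest φ) (i : Fin d) : tsupport (pd i φ) ⊆ tsupport φ := by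
  rw [pd_eq h]
  exact tsupport_fderiv_apply_subset ℝ _

lemma IsTest.pd {φ : Ed d → ℝ} (h : IsTest φ) (i : Fin d) : IsTest (pd i φ) := by
  refine ⟨?_, h.2.mono' ((subset_tsupport _).trans (tsupport_pd h i))⟩
  rw [pd_eq h]
  exact (h.1.fderiv_right (m := (⊤ : ℕ∞)) (by simp)).clm_apply contDiff_const

/-- Test function with the support inclusion in `T`. -/
def TestIn (T : Set (Ed d)) (φ : Ed d → ℝ) : Prop := IsTest φ ∧ tsupport φ ⊆ T

lemma TestIn.pd {T : Set (Ed d)} {φ : Ed d → ℝ} (h : TestIn T φ) (i : Fin d) :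
    TestIn T (pd i φ) := ⟨h.1.pd i, (tsupport_pd h.1 i).trans h.2⟩

lemma TestIn.pd_iter {T : Set (Ed d)} {φ : Ed d → ℝ} (h : TestIn T φ) (i : Fin d) (n : ℕ) :
    TestIn T ((_root_.pd i)^[n] φ) := by
  induction n with
  | zero => simpa using h
  | succ n ih => rw [Function.iterate_succ_apply']; exact ih.pd i

lemma TestIn.foldr {T : Set (Ed d)} {φ : Ed d → ℝ} (h : TestIn T φ) (k : MIdx d)
    (L : List (Fin d)) : TestIn T (L.foldr (fun i g => (_root_.pd i)^[k i] g) φ) := by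
  induction L with
  | nil => simpa using h
  | cons a L ih => simpa using ih.pd_iter a (k a)

lemma TestIn.mderiv {T : Set (Ed d)} {φ : Ed d → ℝ} (h : TestIn T φ) (k : MIdx d) :
    TestIn T (mderiv k φ) := h.foldr k _

lemma IsTest.mderiv {φ : Ed d → ℝ} (h : IsTest φ) (k : MIdx d) : IsTest (mderiv k φ) :=
  (TestIn.mderiv (T := tsupport φ) ⟨h, subset_rfl⟩ k).1

lemma TestIn.add {T : Set (Ed d)} {φ ψ : Ed d → ℝ} (h : TestIn T φ) (h' : TestIn T ψ) :
    TestIn T (φ + ψ) :=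
  ⟨h.1.add h'.1, (tsupport_add φ ψ).trans (Set.union_subset h.2 h'.2)⟩

lemma TestIn.smul {T : Set (Ed d)} {φ : Ed d → ℝ} (c : ℝ) (h : TestIn T φ) :
    TestIn T (c • φ) :=
  ⟨h.1.smul c, (tsupport_smul_subset_right (fun _ => c) φ).trans h.2⟩

lemma testIn_zero (T : Set (Ed d)) : TestIn T (0 : Ed d → ℝ) :=
  ⟨isTest_zero, by simp [tsupport]⟩

/-! ### linearity of derivatives -/

lemma pd_add {φ ψ : Ed d → ℝ} (h : IsTest φ) (h' : IsTest ψ) (i : Fin d) :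
    pd i (φ + ψ) = pd i φ + pd i ψ := by
  rw [pd_eq h, pd_eq h', pd_eq (h.add h')]
  funext x
  rw [fderiv_add (h.diff x) (h'.diff x)]; rfl

lemma pd_smul (c : ℝ) (φ : Ed d → ℝ) (i : Fin d) :
    pd i (c • φ) = c • pd i φ := by
  funext x
  simp [pd, lineDeriv]

lemma pd_iter_add {φ ψ : Ed d → ℝ} (h : IsTest φ) (h' : IsTest ψ) (i : Fin d) (n : ℕ) :
    (pd i)^[n] (φ + ψ) = (pd i)^[n] φ + (pd i)^[n] ψ := by
  induction n with
  | zero => rfl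
  | succ n ih =>
    rw [Function.iterate_succ_apply', ih, Function.iterate_succ_apply',
      Function.iterate_succ_apply', pd_add]
    · exact (TestIn.pd_iter (T := Set.univ) ⟨h, Set.subset_univ _⟩ i n).1
    · exact (TestIn.pd_iter (T := Set.univ) ⟨h', Set.subset_univ _⟩ i n).1

lemma pd_iter_smul (c : ℝ) (φ : Ed d → ℝ) (i : Fin d) (n : ℕ) :
    (pd i)^[n] (c • φ) = c • (pd i)^[n] φ := by
  induction n with
  | zero => rfl
  | succ n ih => rw [Function.iterate_succ_apply', ih, Function.iterate_succ_apply', pd_smul]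

lemma mderiv_add {φ ψ : Ed d → ℝ} (h : IsTest φ) (h' : IsTest ψ) (k : MIdx d) :
    mderiv k (φ + ψ) = mderiv k φ + mderiv k ψ := by
  unfold mderiv
  induction List.finRange d with
  | nil => rfl
  | cons a L ih =>
    simp only [List.foldr_cons]
    rw [ih, pd_iter_add]
    · exact (TestIn.foldr (T := Set.univ) ⟨h, Set.subset_univ _⟩ k L).1
    · exact (TestIn.foldr (T := Set.univ) ⟨h', Set.subset_univ _⟩ k L).1

lemma mderiv_smul (c : ℝ) (φ : Ed d → ℝ) (k : MIdx d) :
    mderiv k (c • φ) = c • mderiv k φ := by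
  unfold mderiv
  induction List.finRange d with
  | nil => rfl
  | cons a L ih =>
    simp only [List.foldr_cons]
    rw [ih, pd_iter_smul]

/-! ### scaling -/

lemma scTF_add (φ ψ : Ed d → ℝ) (x : Ed d) (l : ℝ) :
    scTF (φ + ψ) x l = scTF φ x l + scTF ψ x l := by
  funext y; simp [scTF, mul_add]

lemma scTF_smul (c : ℝ) (φ : Ed d → ℝ) (x : Ed d) (l : ℝ) :
    scTF (c • φ) x l = c • scTF φ x l := by
  funext y; simp [scTF]; ring

lemma scTF_scTF (φ : Ed d → ℝ) (x : Ed d) (a b : ℝ) :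
    scTF (scTF φ 0 a) x b = scTF φ x (a * b) := by
  funext y
  simp only [scTF, sub_zero, smul_smul, mul_pow, mul_inv]
  ring

lemma pd_scTF (φ : Ed d → ℝ) (x : Ed d) (l : ℝ) (i : Fin d) :
    pd i (scTF φ x l) = l⁻¹ • scTF (pd i φ) x l := by
  funext y
  simp only [pd, lineDeriv, scTF, Pi.smul_apply, smul_eq_mul]
  rw [deriv_const_mul_field]
  have : (fun t : ℝ => φ (l⁻¹ • (y + t • EuclideanSpace.single i (1:ℝ) - x))) =
      fun t => (fun s : ℝ => φ (l⁻¹ • (y - x) + s • EuclideanSpace.single i (1:ℝ))) (l⁻¹ * t) := by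
    funext t
    congr 1
    rw [mul_smul]; module
  rw [this, deriv_comp_mul_left l⁻¹
    (fun s : ℝ => φ (l⁻¹ • (y - x) + s • EuclideanSpace.single i (1:ℝ))) 0]
  simp; ring

lemma pd_iter_scTF (φ : Ed d → ℝ) (x : Ed d) (l : ℝ) (i : Fin d) (n : ℕ) :
    (pd i)^[n] (scTF φ x l) = (l⁻¹) ^ n • scTF ((pd i)^[n] φ) x l := by
  induction n with
  | zero => simp
  | succ n ih =>
    rw [Function.iterate_succ_apply', ih, Function.iterate_succ_apply', pd_smul, pd_scTF,
      smul_smul, pow_succ]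

lemma mderiv_scTF (φ : Ed d → ℝ) (x : Ed d) (l : ℝ) (k : MIdx d) :
    mderiv k (scTF φ x l) = (l⁻¹) ^ (mdeg k) • scTF (mderiv k φ) x l := by
  have key : ∀ L : List (Fin d), L.foldr (fun i g => (pd i)^[k i] g) (scTF φ x l) =
      (l⁻¹) ^ ((L.map k).sum) • scTF (L.foldr (fun i g => (pd i)^[k i] g) φ) x l := by
    intro L
    induction L with
    | nil => simp
    | cons a L ih =>
      simp only [List.foldr_cons, List.map_cons, List.sum_cons]
      rw [ih, pd_iter_smul, pd_iter_scTF, smul_smul, pow_add, mul_comm]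
  have := key (List.finRange d)
  rw [show mdeg k = ((List.finRange d).map k).sum from by
    rw [mdeg, ← List.sum_ofFn, List.ofFn_eq_map]]
  exact this

lemma testIn_scTF {φ : Ed d → ℝ} {R : ℝ} (h : TestIn (closedBall 0 R) φ) (x : Ed d) {l : ℝ}
    (hl : 0 < l) : TestIn (closedBall x (l * R)) (scTF φ x l) := by
  have hs : Function.support (scTF φ x l) ⊆ closedBall x (l * R) := by
    intro y hy
    have h1 : φ (l⁻¹ • (y - x)) ≠ 0 := by
      intro h0; exact hy (by simp [scTF, h0])
    have h2 := h.2 (subset_tsupport _ h1)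
    rw [mem_closedBall_zero_iff, norm_smul, norm_inv, Real.norm_of_nonneg hl.le,
      inv_mul_le_iff₀ hl] at h2
    rwa [mem_closedBall, dist_eq_norm]
  refine ⟨⟨?_, ?_⟩, closure_minimal hs isClosed_closedBall⟩
  · unfold scTF
    have := h.1.1
    fun_prop
  · exact HasCompactSupport.of_support_subset_isCompact (isCompact_closedBall _ _) hs

lemma IsTest.exists_ball {φ : Ed d → ℝ} (h : IsTest φ) :
    ∃ R : ℝ, 1 ≤ R ∧ TestIn (closedBall 0 R) φ := by
  obtain ⟨R, hR⟩ := h.2.isCompact.isBounded.subset_closedBall 0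
  exact ⟨max R 1, le_max_right _ _, h, hR.trans (closedBall_subset_closedBall (le_max_left _ _))⟩

lemma IsTest.scTF {φ : Ed d → ℝ} (h : IsTest φ) (x : Ed d) {l : ℝ} (hl : 0 < l) :
    IsTest (scTF φ x l) := by
  obtain ⟨R, -, hR⟩ := h.exists_ball
  exact (testIn_scTF hR x hl).1

/-! ### quantitative bounds -/

/-- test function in the unit ball with derivatives up to order `r` bounded by `M`. -/
def BdT (r : ℕ) (M : ℝ) (φ : Ed d → ℝ) : Prop :=
  TestIn (closedBall 0 1) φ ∧ ∀ k : MIdx d, mdeg k ≤ r → ∀ x, |mderiv k φ x| ≤ M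

lemma mderiv_zero_idx (φ : Ed d → ℝ) (k : MIdx d) (hk : k = 0) : mderiv k φ = φ := by
  subst hk
  unfold mderiv
  induction List.finRange d with
  | nil => rfl
  | cons a L ih => simpa using ih

lemma mdeg_zero : mdeg (0 : MIdx d) = 0 := by simp [mdeg]

lemma BdT.abs_le {r : ℕ} {M : ℝ} {φ : Ed d → ℝ} (h : BdT r M φ) (x : Ed d) : |φ x| ≤ M := by
  simpa only [mderiv_zero_idx _ 0 rfl] using h.2 0 (by simp [mdeg_zero]) x

lemma BdT.nonneg {r : ℕ} {M : ℝ} {φ : Ed d → ℝ} (h : BdT r M φ) : 0 ≤ M :=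
  (abs_nonneg _).trans (h.abs_le 0)

lemma bdT_one_iff {r : ℕ} {φ : Ed d → ℝ} : BdT r 1 φ ↔ φ ∈ TB d r := by
  simp only [BdT, TestIn, TB, Set.mem_ofPred_eq, and_assoc]

lemma BdT.add {r : ℕ} {M N : ℝ} {φ ψ : Ed d → ℝ} (h : BdT r M φ) (h' : BdT r N ψ) :
    BdT r (M + N) (φ + ψ) := by
  refine ⟨h.1.add h'.1, fun k hk x => ?_⟩
  rw [mderiv_add h.1.1 h'.1.1]
  exact (abs_add_le _ _).trans (add_le_add (h.2 k hk x) (h'.2 k hk x))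

lemma BdT.smul {r : ℕ} {M : ℝ} {φ : Ed d → ℝ} (c : ℝ) (h : BdT r M φ) :
    BdT r (|c| * M) (c • φ) := by
  refine ⟨h.1.smul c, fun k hk x => ?_⟩
  rw [mderiv_smul, Pi.smul_apply, smul_eq_mul, abs_mul]
  exact mul_le_mul_of_nonneg_left (h.2 k hk x) (abs_nonneg _)

lemma BdT.mono {r : ℕ} {M N : ℝ} {φ : Ed d → ℝ} (h : BdT r M φ) (hMN : M ≤ N) :
    BdT r N φ := ⟨h.1, fun k hk x => (h.2 k hk x).trans hMN⟩

lemma bdT_zero (r : ℕ) : BdT r 0 (0 : Ed d → ℝ) := by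
  refine ⟨testIn_zero _, fun k _ x => ?_⟩
  have := mderiv_smul 0 (0 : Ed d → ℝ) k
  rw [zero_smul, zero_smul] at this
  simp [this]

lemma bdT_sum {ι : Type*} (s : Finset ι) (f : ι → Ed d → ℝ) (M : ι → ℝ) (r : ℕ)
    (h : ∀ i ∈ s, BdT r (M i) (f i)) :
    BdT r (∑ i ∈ s, M i) (∑ i ∈ s, f i) := by
  induction s using Finset.induction_on with
  | empty => simpa using bdT_zero r
  | insert a s ha ih =>
    rw [Finset.sum_insert ha, Finset.sum_insert ha]
    exact (h a (by simp)).add (ih fun i hi => h i (by simp [hi]))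

lemma finite_mdeg_le (N : ℕ) : {k : MIdx d | mdeg k ≤ N}.Finite := by
  refine (Set.finite_Iic (fun _ => N : MIdx d)).subset ?_
  intro k hk i
  exact (Finset.single_le_sum (f := k) (fun _ _ => Nat.zero_le _) (Finset.mem_univ i)).trans hk

/-- The finite set of multi-indices of degree at most `N`. -/
def idx (d N : ℕ) : Finset (MIdx d) := (finite_mdeg_le (d := d) N).toFinset

lemma mem_idx {N : ℕ} {k : MIdx d} : k ∈ idx d N ↔ mdeg k ≤ N := by simp [idx]

lemma IsTest.bdd {φ : Ed d → ℝ} (h : IsTest φ) : ∃ M, ∀ x, |φ x| ≤ M := by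
  obtain ⟨M, hM⟩ := h.2.exists_bound_of_continuous h.1.continuous
  exact ⟨M, hM⟩

lemma exists_bdT (r : ℕ) {φ : Ed d → ℝ} (h : TestIn (closedBall 0 1) φ) :
    ∃ M, 0 < M ∧ BdT r M φ := by
  choose M hM using fun k : MIdx d => (h.1.mderiv k).bdd
  have h0 : ∀ k, 0 ≤ M k := fun k => (abs_nonneg _).trans (hM k 0)
  refine ⟨∑ k ∈ idx d r, M k + 1, by have := Finset.sum_nonneg fun k (_ : k ∈ idx d r) => h0 k; linarith, h, fun k hk x => ?_⟩
  have := Finset.single_le_sum (fun k _ => h0 k) (mem_idx.2 hk)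
  linarith [hM k x]

/-- Uniform bounds for `∂^k (η^θ)`, `θ ∈ [θ₀,1]`. -/
lemma exists_bdT_mderiv_scTF (r : ℕ) {φ : Ed d → ℝ} (h : TestIn (closedBall 0 1) φ) (k : MIdx d)
    {t₀ : ℝ} (ht₀ : 0 < t₀) :
    ∃ M, 0 < M ∧ ∀ t, t₀ ≤ t → t ≤ 1 → BdT r M (mderiv k (scTF φ 0 t)) := by
  obtain ⟨M, hM0, hM⟩ := exists_bdT r (h.mderiv k)
  have key : ∀ t, t₀ ≤ t → t ≤ 1 → ∀ n : ℕ, (t⁻¹) ^ n ≤ (t₀⁻¹) ^ n := by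
    intro t ht _ n
    have : 0 < t := ht₀.trans_le ht
    gcongr
  refine ⟨(t₀⁻¹) ^ mdeg k * ((t₀⁻¹) ^ r * ((t₀⁻¹) ^ d * M)), by positivity, fun t ht ht1 => ?_⟩
  have ht' : 0 < t := ht₀.trans_le ht
  have hle1 : (1:ℝ) ≤ t⁻¹ := (one_le_inv₀ ht').2 ht1
  have hT : TestIn (closedBall 0 1) (scTF φ 0 t) := by
    obtain ⟨h1, h2⟩ := testIn_scTF h 0 ht'
    exact ⟨h1, h2.trans (closedBall_subset_closedBall (by linarith))⟩
  refine ⟨hT.mderiv k, fun j hj x => ?_⟩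
  rw [mderiv_scTF, mderiv_smul, mderiv_scTF]
  simp only [Pi.smul_apply, smul_eq_mul, abs_mul, scTF, ← inv_pow]
  rw [abs_of_nonneg (by positivity), abs_of_nonneg (by positivity), abs_of_nonneg (by positivity)]
  gcongr ?_ * (?_ * (?_ * ?_))
  · exact key t ht ht1 _
  · exact (pow_le_pow_right₀ hle1 hj).trans (key t ht ht1 _)
  · exact key t ht ht1 _
  · exact hM.2 j hj _

/-! ### moments -/

/-- The moment `∫ φ(z) z^j dz`. -/
def mom (j : MIdx d) (φ : Ed d → ℝ) : ℝ := ∫ z, φ z * mpow z j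

lemma continuous_mpow (j : MIdx d) : Continuous (fun z : Ed d => mpow z j) := by
  unfold mpow; fun_prop

lemma IsTest.integrable {φ : Ed d → ℝ} (h : IsTest φ) {g : Ed d → ℝ} (hg : Continuous g) :
    Integrable (fun z => φ z * g z) := by
  refine (h.1.continuous.mul hg).integrable_of_hasCompactSupport ?_
  exact h.2.mul_right

lemma mom_add {φ ψ : Ed d → ℝ} (h : IsTest φ) (h' : IsTest ψ) (j : MIdx d) :
    mom j (φ + ψ) = mom j φ + mom j ψ := by
  unfold mom
  rw [← integral_add (h.integrable (continuous_mpow j)) (h'.integrable (continuous_mpow j))]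
  simp [add_mul]

lemma mom_smul (c : ℝ) (φ : Ed d → ℝ) (j : MIdx d) : mom j (c • φ) = c * mom j φ := by
  unfold mom
  rw [← integral_const_mul]
  simp [mul_assoc]

lemma mom_sum {ι : Type*} (s : Finset ι) (f : ι → Ed d → ℝ) (h : ∀ i ∈ s, IsTest (f i))
    (j : MIdx d) : mom j (∑ i ∈ s, f i) = ∑ i ∈ s, mom j (f i) := by
  induction s using Finset.induction_on with
  | empty => simp [mom]
  | insert a s ha ih =>
    rw [Finset.sum_insert ha, Finset.sum_insert ha, mom_add (h a (by simp))
      (isTest_sum s f fun i hi => h i (by simp [hi])), ih fun i hi => h i (by simp [hi])]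

lemma hasLineDerivAt_mpow (j : MIdx d) (i : Fin d) (z : Ed d) :
    HasLineDerivAt ℝ (fun z => mpow z j)
      ((j i : ℝ) * mpow z (Function.update j i (j i - 1))) z (EuclideanSpace.single i (1:ℝ)) := by
  unfold HasLineDerivAt
  have h1 : ∀ (w : Ed d) (m : MIdx d),
      mpow w m = (w i) ^ (m i) * ∏ p ∈ Finset.univ.erase i, (w p) ^ (m p) := by
    intro w m
    exact (Finset.mul_prod_erase Finset.univ (fun p => (w p) ^ (m p)) (Finset.mem_univ i)).symm
  have h2 : (fun t : ℝ => mpow (z + t • EuclideanSpace.single i (1:ℝ)) j) =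
      fun t => (z i + t) ^ (j i) * ∏ p ∈ Finset.univ.erase i, (z p) ^ (j p) := by
    funext t
    rw [h1]
    congr 1
    · simp
    · refine Finset.prod_congr rfl fun p hp => ?_
      simp [Finset.ne_of_mem_erase hp]
  rw [h2, h1 z]
  have h3 : ∏ p ∈ Finset.univ.erase i, (z p) ^ (Function.update j i (j i - 1) p)
      = ∏ p ∈ Finset.univ.erase i, (z p) ^ (j p) := by
    refine Finset.prod_congr rfl fun p hp => ?_
    simp [Finset.ne_of_mem_erase hp]
  rw [h3, ← mul_assoc]
  refine HasDerivAt.mul_const ?_ _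
  have h4 : HasDerivAt (fun t : ℝ => z i + t) 1 0 := (hasDerivAt_id (0:ℝ)).const_add (z i)
  have h5 := h4.fun_pow (j i)
  simp only [add_zero, mul_one] at h5
  simpa using h5

lemma mom_pd {φ : Ed d → ℝ} (h : IsTest φ) (j : MIdx d) (i : Fin d) :
    mom j (pd i φ) = -((j i : ℝ) * mom (Function.update j i (j i - 1)) φ) := by
  have key := integral_bilinear_hasLineDerivAt_right_eq_neg_left_of_integrable
    (μ := (volume : Measure (Ed d)))
    (f := fun z => mpow z j) (f' := fun z => (j i : ℝ) * mpow z (Function.update j i (j i - 1)))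
    (g := φ) (g' := pd i φ) (v := EuclideanSpace.single i (1:ℝ))
    (B := ContinuousLinearMap.mul ℝ ℝ) ?_ ?_ ?_ ?_ ?_
  · simp only [ContinuousLinearMap.mul_apply'] at key
    unfold mom
    rw [← integral_const_mul]
    calc _ = ∫ z, mpow z j * pd i φ z := by simp only [mul_comm]
      _ = _ := by
        rw [key]; congr 2; funext z; ring
  · have := h.integrable ((continuous_mpow (Function.update j i (j i - 1))).const_mul (j i : ℝ))
    simpa [mul_comm, mul_left_comm] using this
  · have := (h.pd i).integrable (continuous_mpow j)
    simpa [mul_comm] using this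
  · have := h.integrable (continuous_mpow j)
    simpa [mul_comm] using this
  · exact fun z _ => hasLineDerivAt_mpow j i z
  · intro z _
    rw [pd_eq h]
    exact (h.diff z).hasFDerivAt.hasLineDerivAt _

lemma mom_pd_iter {φ : Ed d → ℝ} (h : IsTest φ) (i : Fin d) (n : ℕ) (j : MIdx d) :
    mom j ((pd i)^[n] φ) =
      ((-1) ^ n * ((j i).descFactorial n : ℝ)) * mom (Function.update j i (j i - n)) φ := by
  induction n generalizing j with
  | zero => simp
  | succ n ih =>
    rw [Function.iterate_succ_apply',
      mom_pd (TestIn.pd_iter (T := Set.univ) ⟨h, Set.subset_univ _⟩ i n).1, ih]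
    simp only [Function.update_self, Function.update_idem]
    rcases hj : j i with _ | m
    · simp
    · rw [Nat.succ_descFactorial_succ]
      have : m + 1 - 1 - n = m + 1 - (n + 1) := by omega
      rw [this]
      simp only [Nat.add_sub_cancel]
      push_cast
      ring

lemma mom_mderiv {φ : Ed d → ℝ} (h : IsTest φ) (j k : MIdx d) :
    mom j (mderiv k φ) =
      (∏ i, ((-1) ^ (k i) * ((j i).descFactorial (k i) : ℝ))) * mom (fun i => j i - k i) φ := by
  have key : ∀ L : List (Fin d), L.Nodup → ∀ j : MIdx d,
      mom j (L.foldr (fun i g => (pd i)^[k i] g) φ) =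
        (∏ i ∈ L.toFinset, ((-1) ^ (k i) * ((j i).descFactorial (k i) : ℝ))) *
          mom (fun i => if i ∈ L then j i - k i else j i) φ := by
    intro L
    induction L with
    | nil => intro _ j; simp
    | cons a L ih =>
      intro hL j
      rw [List.nodup_cons] at hL
      simp only [List.foldr_cons, List.toFinset_cons]
      rw [mom_pd_iter (TestIn.foldr (T := Set.univ) ⟨h, Set.subset_univ _⟩ k L).1, ih hL.2,
        Finset.prod_insert (by simpa using hL.1), ← mul_assoc]
      congr 1
      · congr 1
        refine Finset.prod_congr rfl fun p hp => ?_
        have : p ≠ a := by rintro rfl; exact hL.1 (by simpa using hp)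
        simp [this]
      · congr 1
        funext p
        by_cases hp : p = a
        · subst hp; simp [hL.1]
        · simp [hp]
  have := key (List.finRange d) (List.nodup_finRange d) j
  simpa [mderiv] using this

lemma mom_mderiv_self {φ : Ed d → ℝ} (h : IsTest φ) (k : MIdx d) :
    mom k (mderiv k φ) = (-1) ^ (mdeg k) * (mfact k : ℝ) * mom 0 φ := by
  rw [mom_mderiv h]
  have : (fun i => k i - k i) = (0 : MIdx d) := by funext i; simp
  rw [this, Finset.prod_mul_distrib, Finset.prod_pow_eq_pow_sum]
  simp [mdeg, mfact, Nat.descFactorial_self]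

/-- The moments of `∂^k φ` vanish off the diagonal if the moments of `φ` do. -/
lemma mom_mderiv_of_ne {φ : Ed d → ℝ} (h : IsTest φ) {j k : MIdx d} (hjk : j ≠ k)
    (h0 : ∀ m : MIdx d, 1 ≤ mdeg m → mdeg m + mdeg k = mdeg j → mom m φ = 0) :
    mom j (mderiv k φ) = 0 := by
  rw [mom_mderiv h]
  by_cases hle : ∀ i, k i ≤ j i
  · have hs : mdeg (fun i => j i - k i) + mdeg k = mdeg j := by
      simp only [mdeg, ← Finset.sum_add_distrib]
      exact Finset.sum_congr rfl fun i _ => Nat.sub_add_cancel (hle i)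
    rw [h0 _ _ hs, mul_zero]
    by_contra hlt
    have h1 : mdeg (fun i => j i - k i) = 0 := by omega
    refine hjk (funext fun i => ?_)
    have := (Finset.sum_eq_zero_iff.1 h1) i (Finset.mem_univ i)
    have := hle i
    omega
  · push Not at hle
    obtain ⟨i, hi⟩ := hle
    rw [Finset.prod_eq_zero (Finset.mem_univ i), zero_mul]
    simp [Nat.descFactorial_of_lt hi]

lemma mpow_smul (c : ℝ) (z : Ed d) (j : MIdx d) : mpow (c • z) j = c ^ (mdeg j) * mpow z j := by
  simp [mpow, mul_pow, Finset.prod_mul_distrib, Finset.prod_pow_eq_pow_sum, mdeg]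

lemma integral_scTF_mpow (φ : Ed d → ℝ) (x : Ed d) {l : ℝ} (hl : 0 < l) (j : MIdx d) :
    ∫ y, scTF φ x l y * mpow (y - x) j = l ^ (mdeg j) * mom j φ := by
  have h1 : (fun y => scTF φ x l y * mpow (y - x) j) =
      fun y => (fun z => (l ^ d)⁻¹ * (l ^ mdeg j) *
        ((fun w => φ w * mpow w j) (l⁻¹ • z))) (y - x) := by
    funext y
    simp only [scTF]
    rw [mpow_smul]
    have : l ^ mdeg j * (l⁻¹) ^ mdeg j = 1 := by
      rw [← mul_pow, mul_inv_cancel₀ hl.ne', one_pow]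
    linear_combination (-(l ^ d)⁻¹ * φ (l⁻¹ • (y - x)) * mpow (y - x) j) * this
  rw [h1, integral_sub_right_eq_self (fun z => (l ^ d)⁻¹ * (l ^ mdeg j) *
        ((fun w => φ w * mpow w j) (l⁻¹ • z))) x, integral_const_mul,
        Measure.integral_comp_inv_smul_of_nonneg volume (fun w => φ w * mpow w j) hl.le]
  simp only [finrank_euclideanSpace, Fintype.card_fin, smul_eq_mul, mom]
  field_simp

lemma mom_scTF (φ : Ed d → ℝ) {l : ℝ} (hl : 0 < l) (j : MIdx d) :
    mom j (scTF φ 0 l) = l ^ (mdeg j) * mom j φ := by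
  have := integral_scTF_mpow φ 0 hl j
  simpa [mom] using this

lemma abs_mpow_le {z : Ed d} (hz : ‖z‖ ≤ 1) (j : MIdx d) : |mpow z j| ≤ 1 := by
  unfold mpow
  rw [Finset.abs_prod]
  refine Finset.prod_le_one (fun _ _ => abs_nonneg _) fun i _ => ?_
  rw [abs_pow]
  refine pow_le_one₀ (abs_nonneg _) ?_
  exact (PiLp.norm_apply_le z i).trans hz

/-- volume of the unit ball -/
def vB (d : ℕ) : ℝ := (volume : Measure (Ed d)).real (closedBall 0 1)

lemma vB_nonneg : 0 ≤ vB d := measureReal_nonneg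

lemma BdT.abs_mom_le {r : ℕ} {M : ℝ} {φ : Ed d → ℝ} (h : BdT r M φ) (j : MIdx d) :
    |mom j φ| ≤ M * vB d := by
  unfold mom
  have h1 : ∫ z, φ z * mpow z j = ∫ z in closedBall (0 : Ed d) 1, φ z * mpow z j := by
    symm
    refine setIntegral_eq_integral_of_forall_compl_eq_zero fun z hz => ?_
    rw [image_eq_zero_of_notMem_tsupport (fun hh => hz (h.1.2 hh)), zero_mul]
  rw [h1, ← Real.norm_eq_abs]
  refine norm_setIntegral_le_of_norm_le_const (isCompact_closedBall _ _).measure_lt_top ?_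
  intro z hz
  rw [mem_closedBall_zero_iff] at hz
  rw [norm_mul, Real.norm_eq_abs, Real.norm_eq_abs]
  exact (mul_le_mul (h.abs_le z) (abs_mpow_le hz j) (abs_nonneg _) h.nonneg).trans_eq (mul_one _)

/-- Existence of a mollifier with vanishing moments. -/
lemma exists_eta (d N : ℕ) : ∃ η : Ed d → ℝ, TestIn (closedBall 0 1) η ∧ mom 0 η = 1 ∧
    ∀ j : MIdx d, 1 ≤ mdeg j → mdeg j ≤ N → mom j η = 0 := by
  let b : ContDiffBump (0 : Ed d) := ⟨1/2, 1, by norm_num, by norm_num⟩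
  let ρ : Ed d → ℝ := fun z => b.normed volume z
  have hρ : TestIn (closedBall 0 1) ρ := by
    refine ⟨⟨b.contDiff_normed, b.hasCompactSupport_normed⟩, ?_⟩
    exact (b.tsupport_normed_eq (μ := volume)).subset
  have hρ1 : mom 0 ρ = 1 := by
    simp [mom, mpow, ρ, b.integral_normed]
  let θ : Fin (N + 1) → ℝ := fun i => ((i : ℝ) + 1)⁻¹
  have hθ : ∀ i, 0 < θ i := fun i => by positivity
  have hθ1 : ∀ i, θ i ≤ 1 := fun i => inv_le_one_of_one_le₀ (by simp)
  have hinj : Function.Injective θ := by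
    intro i j hij
    have : (i : ℝ) + 1 = (j : ℝ) + 1 := inv_injective hij
    have : ((i : ℕ) : ℝ) = ((j : ℕ) : ℝ) := by linarith
    exact Fin.ext (by exact_mod_cast this)
  let V := Matrix.vandermonde θ
  have hV : IsUnit V.det := (Matrix.det_vandermonde_ne_zero_iff.2 hinj).isUnit
  let e : Fin (N + 1) → ℝ := Pi.single 0 1
  let c : Fin (N + 1) → ℝ := Matrix.vecMul e V⁻¹
  have hc : Matrix.vecMul c V = e := by
    simp [c, Matrix.vecMul_vecMul, Matrix.nonsing_inv_mul V hV]
  have hc' : ∀ m : Fin (N + 1), ∑ i, c i * θ i ^ (m : ℕ) = e m := by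
    intro m
    rw [← hc]
    simp [Matrix.vecMul, dotProduct, V, Matrix.vandermonde_apply]
  have ht : ∀ i, TestIn (closedBall 0 1) (c i • scTF ρ 0 (θ i)) := by
    intro i
    refine TestIn.smul _ ?_
    obtain ⟨h1, h2⟩ := testIn_scTF hρ 0 (hθ i)
    exact ⟨h1, h2.trans (closedBall_subset_closedBall (by linarith [hθ1 i]))⟩
  have hm : ∀ j : MIdx d, ∀ hj : mdeg j ≤ N, mom j (∑ i, c i • scTF ρ 0 (θ i)) =
      e ⟨mdeg j, by omega⟩ * mom j ρ := by
    intro j hj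
    rw [mom_sum _ _ fun i _ => (ht i).1, ← hc', Finset.sum_mul]
    refine Finset.sum_congr rfl fun i _ => ?_
    rw [mom_smul, mom_scTF _ (hθ i)]
    ring
  refine ⟨∑ i, c i • scTF ρ 0 (θ i), ?_, ?_, ?_⟩
  · have : ∀ s : Finset (Fin (N+1)), TestIn (closedBall 0 1) (∑ i ∈ s, c i • scTF ρ 0 (θ i)) := by
      intro s
      induction s using Finset.induction_on with
      | empty => simpa using testIn_zero _
      | insert a s ha ih => rw [Finset.sum_insert ha]; exact (ht a).add ih
    exact this _
  · rw [hm 0 (by simp [mdeg_zero]), hρ1]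
    simp [e, mdeg_zero]
  · intro j hj1 hjN
    rw [hm j hjN]
    have : (⟨mdeg j, by omega⟩ : Fin (N+1)) ≠ 0 := by
      intro h0
      have := congrArg Fin.val h0
      simp at this; omega
    simp [e, this]

/-! ### real-variable lemmas -/

lemma telescoping {g : ℝ → ℝ} {b D L : ℝ} (hb : 0 < b) (hD : 0 ≤ D)
    (hg : ∀ l, 0 < l → l ≤ L → ∀ t, 1/2 ≤ t → t ≤ 1 → |g (t * l) - g l| ≤ D * l ^ b)
    {l m : ℝ} (hl : l ≤ L) (hm : 0 < m) (hml : m ≤ l) :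
    |g m - g l| ≤ D * (1 - (1/2 : ℝ) ^ b)⁻¹ * l ^ b := by
  set q : ℝ := (1/2 : ℝ) ^ b with hq
  have hq1 : q < 1 := Real.rpow_lt_one (by norm_num) (by norm_num) hb
  have hq0 : 0 < q := Real.rpow_pos_of_pos (by norm_num) _
  set S := (1 - q)⁻¹ with hS
  have hS1 : S * (1 - q) = 1 := inv_mul_cancel₀ (by linarith)
  have hS0 : 1 ≤ S := (one_le_inv₀ (by linarith)).2 (by linarith)
  have key : ∀ n : ℕ, ∀ l m : ℝ, l ≤ L → 0 < m → m ≤ l → l ≤ 2 ^ n * m →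
      |g m - g l| ≤ D * S * l ^ b := by
    intro n
    induction n with
    | zero =>
      intro l m hl hm hml hlm
      have : m = l := le_antisymm hml (by simpa using hlm)
      subst this
      simp only [sub_self, abs_zero]
      have := Real.rpow_nonneg hm.le b
      positivity
    | succ n ih =>
      intro l m hl hm hml hlm
      have hl0 : 0 < l := hm.trans_le hml
      have hlb := Real.rpow_nonneg hl0.le b
      by_cases hh : l / 2 ≤ m
      · have h1 := hg l hl0 hl (m / l) (by rw [div_le_div_iff₀ (by norm_num) hl0]; linarith)
          ((div_le_one hl0).2 hml)
        rw [div_mul_cancel₀ _ hl0.ne'] at h1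
        refine h1.trans ?_
        have : D ≤ D * S := le_mul_of_one_le_right hD hS0
        exact mul_le_mul_of_nonneg_right this hlb
      · push Not at hh
        have h1 := hg l hl0 hl (1/2) le_rfl (by norm_num)
        have h2 := ih (1/2 * l) m (by linarith) hm (by linarith) (by rw [pow_succ] at hlm; linarith)
        rw [Real.mul_rpow (by norm_num) hl0.le, ← hq] at h2
        calc |g m - g l| ≤ |g m - g (1/2 * l)| + |g (1/2 * l) - g l| := abs_sub_le _ _ _
          _ ≤ D * S * (q * l ^ b) + D * l ^ b := add_le_add h2 h1
          _ = D * S * l ^ b := by linear_combination (- D * l ^ b) * hS1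
  obtain ⟨n, hn⟩ := pow_unbounded_of_one_lt (l / m) (one_lt_two (α := ℝ))
  exact key n l m hl hm hml (by rw [div_lt_iff₀ hm] at hn; exact hn.le)

lemma exists_limit {g : ℝ → ℝ} {b D L : ℝ} (hb : 0 < b) (hD : 0 ≤ D) (hL : 0 < L)
    (hg : ∀ l, 0 < l → l ≤ L → ∀ t, 1/2 ≤ t → t ≤ 1 → |g (t * l) - g l| ≤ D * l ^ b) :
    ∃ v, Tendsto g (𝓝[>] 0) (𝓝 v) := by
  have hE : Tendsto (fun l : ℝ => D * (1 - (1/2 : ℝ) ^ b)⁻¹ * l ^ b) (𝓝[>] 0) (𝓝 0) := by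
    have h1 : Tendsto (fun l : ℝ => l ^ b) (𝓝 0) (𝓝 0) := by
      have := (Real.continuousAt_rpow_const 0 b (Or.inr hb.le)).tendsto
      rwa [Real.zero_rpow hb.ne'] at this
    have h2 := h1.const_mul (D * (1 - (1/2 : ℝ) ^ b)⁻¹)
    rw [mul_zero] at h2
    exact h2.mono_left nhdsWithin_le_nhds
  have hcau : Cauchy (map g (𝓝[>] (0:ℝ))) := by
    rw [Metric.cauchy_iff]
    refine ⟨inferInstance, fun ε hε => ?_⟩
    have h1 : ∀ᶠ l in 𝓝[>] (0:ℝ), D * (1 - (1/2 : ℝ) ^ b)⁻¹ * l ^ b < ε / 2 :=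
      hE.eventually (gt_mem_nhds (by linarith))
    have h2 : ∀ᶠ l in 𝓝[>] (0:ℝ), l ≤ L := by
      filter_upwards [Ioc_mem_nhdsGT hL] with l hl using hl.2
    have h3 : ∀ᶠ l in 𝓝[>] (0:ℝ), 0 < l := self_mem_nhdsWithin
    obtain ⟨l, ⟨hl1, hl2⟩, hl3⟩ := ((h1.and h2).and h3).exists
    refine ⟨g '' Set.Ioc 0 l, image_mem_map (Ioc_mem_nhdsGT hl3), ?_⟩
    rintro _ ⟨p, hp, rfl⟩ _ ⟨q, hq, rfl⟩
    have hp' := telescoping hb hD hg hl2 hp.1 hp.2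
    have hq' := telescoping hb hD hg hl2 hq.1 hq.2
    rw [Real.dist_eq]
    have := abs_sub_le (g p) (g l) (g q)
    rw [abs_sub_comm (g l)] at this
    linarith
  exact CompleteSpace.complete hcau

lemma limit_bound {g : ℝ → ℝ} {b D L v : ℝ} (hb : 0 < b) (hD : 0 ≤ D)
    (hg : ∀ l, 0 < l → l ≤ L → ∀ t, 1/2 ≤ t → t ≤ 1 → |g (t * l) - g l| ≤ D * l ^ b)
    (hv : Tendsto g (𝓝[>] 0) (𝓝 v)) {l : ℝ} (hl0 : 0 < l) (hl : l ≤ L) :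
    |g l - v| ≤ D * (1 - (1/2 : ℝ) ^ b)⁻¹ * l ^ b := by
  have h1 : Tendsto (fun m => |g m - g l|) (𝓝[>] 0) (𝓝 |v - g l|) := (hv.sub_const _).abs
  rw [abs_sub_comm]
  refine le_of_tendsto h1 ?_
  filter_upwards [Ioc_mem_nhdsGT hl0] with m hm
  exact telescoping hb hD hg hl hm.1 hm.2

lemma log_growth {g : ℝ → ℝ} {D : ℝ} (hD : 0 ≤ D)
    (hg : ∀ l, 0 < l → l ≤ 1 → ∀ t, 1/2 ≤ t → t ≤ 1 → |g (t * l) - g l| ≤ D)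
    {n : ℕ} (hn : 1 ≤ n) : Tendsto (fun l => l ^ n * g l) (𝓝[>] 0) (𝓝 0) := by
  set M := 4 * D + |g 1| with hM
  have hM0 : 0 ≤ M := by positivity
  have key : ∀ n : ℕ, ∀ m : ℝ, 0 < m → m ≤ 1 → 1 ≤ 2 ^ n * m → √m * |g m| ≤ M := by
    intro n
    induction n with
    | zero =>
      intro m hm hm1 h
      have : m = 1 := le_antisymm hm1 (by simpa using h)
      subst this
      simp; linarith
    | succ n ih =>
      intro m hm hm1 h
      have hs1 : √m ≤ 1 := Real.sqrt_le_one.2 hm1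
      have hs0 : 0 ≤ √m := Real.sqrt_nonneg _
      by_cases hh : 1/2 ≤ m
      · have h1 := hg 1 one_pos le_rfl m hh hm1
        rw [mul_one] at h1
        have h2 : |g m| ≤ |g 1| + D := by
          have := abs_sub_abs_le_abs_sub (g m) (g 1); linarith
        have : √m * |g m| ≤ 1 * |g m| := mul_le_mul_of_nonneg_right hs1 (abs_nonneg _)
        linarith
      · push Not at hh
        have h1 := hg (2 * m) (by linarith) (by linarith) (1/2) le_rfl (by norm_num)
        rw [show (1/2 : ℝ) * (2 * m) = m by ring] at h1
        have h2 : |g m| ≤ |g (2 * m)| + D := by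
          have := abs_sub_abs_le_abs_sub (g m) (g (2 * m)); linarith
        have h3 := ih (2 * m) (by linarith) (by linarith) (by rw [pow_succ] at h; linarith)
        rw [Real.sqrt_mul (by norm_num)] at h3
        have h4 : (4/3 : ℝ) ≤ √2 := Real.le_sqrt_of_sq_le (by norm_num)
        have h5 : (4/3) * (√m * |g (2 * m)|) ≤ M := by
          refine le_trans ?_ h3
          rw [mul_assoc]
          exact mul_le_mul_of_nonneg_right h4 (by positivity)
        have h6 : √m * |g m| ≤ √m * |g (2 * m)| + √m * D := by
          rw [← mul_add]; exact mul_le_mul_of_nonneg_left h2 hs0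
        have h7 : √m * D ≤ D := mul_le_of_le_one_left hD hs1
        have := abs_nonneg (g 1)
        linarith
  have h0 : Tendsto (fun l : ℝ => M * √l) (𝓝[>] 0) (𝓝 0) := by
    have : Tendsto (fun l : ℝ => M * √l) (𝓝 0) (𝓝 (M * √0)) :=
      (continuous_const.mul Real.continuous_sqrt).tendsto 0
    simp only [Real.sqrt_zero, mul_zero] at this
    exact this.mono_left nhdsWithin_le_nhds
  refine squeeze_zero_norm' ?_ h0
  filter_upwards [Ioc_mem_nhdsGT (zero_lt_one' ℝ)] with l hl
  obtain ⟨m, hm⟩ := pow_unbounded_of_one_lt (1 / l) (one_lt_two (α := ℝ))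
  have h1 := key m l hl.1 hl.2 (by rw [div_lt_iff₀ hl.1] at hm; exact hm.le)
  rw [norm_mul, Real.norm_eq_abs, Real.norm_eq_abs, abs_of_nonneg (pow_nonneg hl.1.le _)]
  have h2 : l ^ n ≤ l := pow_le_of_le_one hl.1.le hl.2 (by omega)
  calc l ^ n * |g l| ≤ l * |g l| := mul_le_mul_of_nonneg_right h2 (abs_nonneg _)
    _ = (√l * |g l|) * √l := by
      nth_rewrite 1 [← Real.mul_self_sqrt hl.1.le]; ring
    _ ≤ M * √l := mul_le_mul_of_nonneg_right h1 (Real.sqrt_nonneg _)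

/-! ### distributions -/

lemma distr_zero {f : DFunc d} (hf : IsDistribution f) : f 0 = 0 := by
  have := hf.2.1 0 0 isTest_zero
  simpa using this

lemma distr_sum {f : DFunc d} (hf : IsDistribution f) {ι : Type*} (s : Finset ι)
    (φ : ι → Ed d → ℝ) (h : ∀ i ∈ s, IsTest (φ i)) : f (∑ i ∈ s, φ i) = ∑ i ∈ s, f (φ i) := by
  induction s using Finset.induction_on with
  | empty => simpa using distr_zero hf
  | insert a s ha ih =>
    rw [Finset.sum_insert ha, Finset.sum_insert ha, hf.1 _ _ (h a (by simp))
      (isTest_sum s φ fun i hi => h i (by simp [hi])), ih fun i hi => h i (by simp [hi])]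

lemma scTF_sum {ι : Type*} (s : Finset ι) (φ : ι → Ed d → ℝ) (x : Ed d) (l : ℝ) :
    scTF (∑ i ∈ s, φ i) x l = ∑ i ∈ s, scTF (φ i) x l := by
  funext y; simp [scTF, Finset.mul_sum]

/-- Rescaling a bounded test function into `𝓑^r`. -/
lemma bdT_scale {r : ℕ} {M : ℝ} (hM : 0 < M) {φ : Ed d → ℝ} (h : BdT r M φ) :
    M⁻¹ • φ ∈ TB d r := by
  rw [← bdT_one_iff]
  refine (h.smul M⁻¹).mono ?_
  rw [abs_of_pos (inv_pos.2 hM), inv_mul_cancel₀ hM.ne']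

lemma distr_scale {f : DFunc d} (hf : IsDistribution f) {M : ℝ} (hM : 0 < M) {φ : Ed d → ℝ}
    (h : IsTest φ) (x : Ed d) {l : ℝ} (hl : 0 < l) :
    f (scTF φ x l) = M * f (scTF (M⁻¹ • φ) x l) := by
  rw [scTF_smul, hf.2.1 _ _ (h.scTF x hl), mul_inv_cancel_left₀ hM.ne']

lemma tb_bound {f : DFunc d} (hf : IsDistribution f) {r : ℕ} {x : Ed d} {l B : ℝ} (hl : 0 < l)
    (hB : ∀ φ ∈ TB d r, |f (scTF φ x l)| ≤ B) {M : ℝ} (hM : 0 < M) {φ : Ed d → ℝ}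
    (h : BdT r M φ) : |f (scTF φ x l)| ≤ M * B := by
  rw [distr_scale hf hM h.1.1 x hl, abs_mul, abs_of_pos hM]
  exact mul_le_mul_of_nonneg_left (hB _ (bdT_scale hM h)) hM.le

lemma ann_bound {f : DFunc d} (hf : IsDistribution f) {r : ℕ} {a : ℝ} {x : Ed d} {l B : ℝ}
    (hl : 0 < l) (hB : ∀ φ ∈ TBAnn d r a, |f (scTF φ x l)| ≤ B) {M : ℝ} (hM : 0 < M)
    {φ : Ed d → ℝ} (h : BdT r M φ) (h0 : ∀ k : MIdx d, (mdeg k : ℝ) ≤ a → mom k φ = 0) :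
    |f (scTF φ x l)| ≤ M * B := by
  rw [distr_scale hf hM h.1.1 x hl, abs_mul, abs_of_pos hM]
  have h1 := bdT_scale hM h
  refine mul_le_mul_of_nonneg_left (hB _ ⟨h1, h1.1, h1.2.1, fun k hk => ?_⟩) hM.le
  have := mom_smul M⁻¹ φ k
  rw [h0 k hk, mul_zero] at this
  exact this

lemma distr_mderiv {f : DFunc d} (hf : IsDistribution f) {φ : Ed d → ℝ} (h : IsTest φ)
    (x : Ed d) {l : ℝ} (hl : 0 < l) (k : MIdx d) :
    f (scTF (mderiv k φ) x l) = (-1) ^ mdeg k * l ^ mdeg k * distDeriv k f (scTF φ x l) := by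
  rw [distDeriv, mderiv_scTF, hf.2.1 _ _ ((h.mderiv k).scTF x hl)]
  have h1 : ((-1:ℝ) ^ mdeg k) * (-1) ^ mdeg k = 1 := by rw [← mul_pow]; simp
  have h2 : l ^ mdeg k * (l⁻¹) ^ mdeg k = 1 := by
    rw [← mul_pow, mul_inv_cancel₀ hl.ne', one_pow]
  linear_combination (-f (scTF (mderiv k φ) x l)) * h2
    - (l ^ mdeg k * (l⁻¹) ^ mdeg k * f (scTF (mderiv k φ) x l)) * h1

/-- The mollifier properties. -/
def Moll (N : ℕ) (η : Ed d → ℝ) : Prop :=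
  TestIn (closedBall 0 1) η ∧ mom 0 η = 1 ∧
    ∀ j : MIdx d, 1 ≤ mdeg j → mdeg j ≤ N → mom j η = 0

lemma Moll.mom_mderiv {N : ℕ} {η : Ed d → ℝ} (h : Moll N η) {j k : MIdx d} (hj : mdeg j ≤ N) :
    mom j (mderiv k η) = if j = k then (-1) ^ (mdeg k) * (mfact k : ℝ) else 0 := by
  split_ifs with hjk
  · subst hjk; rw [mom_mderiv_self h.1.1, h.2.1, mul_one]
  · exact mom_mderiv_of_ne h.1.1 hjk fun m hm1 hm2 => h.2.2 m hm1 (by omega)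

lemma Moll.scTF {N : ℕ} {η : Ed d → ℝ} (h : Moll N η) {t : ℝ} (ht : 0 < t) (ht1 : t ≤ 1) :
    Moll N (scTF η 0 t) := by
  refine ⟨?_, ?_, fun j h1 h2 => ?_⟩
  · obtain ⟨h1, h2⟩ := testIn_scTF h.1 0 ht
    exact ⟨h1, h2.trans (closedBall_subset_closedBall (by linarith))⟩
  · rw [mom_scTF _ ht, mdeg_zero, h.2.1]; simp
  · rw [mom_scTF _ ht, h.2.2 j h1 h2, mul_zero]

lemma mfact_pos (k : MIdx d) : 0 < (mfact k : ℝ) := by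
  have : 0 < mfact k := Finset.prod_pos fun i _ => Nat.factorial_pos _
  exact_mod_cast this

lemma one_le_mfact (k : MIdx d) : 1 ≤ (mfact k : ℝ) := by
  have : 0 < mfact k := Finset.prod_pos fun i _ => Nat.factorial_pos _
  exact_mod_cast this

/-- Key decomposition. -/
lemma key_decomp {N : ℕ} {η : Ed d → ℝ} (hη : Moll N η) (r : ℕ) (a : ℝ)
    (ha : ∀ k : MIdx d, (mdeg k : ℝ) ≤ a → mdeg k ≤ N) :
    ∃ A : ℝ, 0 < A ∧ ∀ f : DFunc d, IsDistribution f → ∀ (x : Ed d) (l B : ℝ), 0 < l →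
      (∀ φ ∈ TBAnn d r a, |f (scTF φ x l)| ≤ B) → ∀ M, 0 < M → ∀ φ, BdT r M φ →
      |f (scTF φ x l) - ∑ k ∈ idx d N,
        (mom k φ / mfact k) * (l ^ mdeg k * distDeriv k f (scTF η x l))| ≤ M * A * B := by
  choose Mk hMk0 hMk using fun k : MIdx d => exists_bdT r (hη.1.mderiv k)
  refine ⟨1 + ∑ k ∈ idx d N, vB d * Mk k, ?_, ?_⟩
  · have : 0 ≤ ∑ k ∈ idx d N, vB d * Mk k :=
      Finset.sum_nonneg fun k _ => mul_nonneg vB_nonneg (hMk0 k).le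
    linarith
  intro f hf x l B hl hB M hM φ hφ
  set c : MIdx d → ℝ := fun k => -((-1) ^ mdeg k * (mom k φ / mfact k)) with hc
  set ρ : Ed d → ℝ := φ + ∑ k ∈ idx d N, c k • mderiv k η with hρ
  have hck : ∀ k, |c k| ≤ M * vB d := by
    intro k
    rw [hc]
    simp only [abs_neg, abs_mul, abs_pow, abs_one, one_pow, one_mul, abs_div]
    rw [abs_of_pos (mfact_pos k)]
    exact (div_le_self (abs_nonneg _) (one_le_mfact k)).trans (hφ.abs_mom_le k)
  have hT : ∀ k ∈ idx d N, IsTest (c k • mderiv k η) := fun k _ => (hη.1.1.mderiv k).smul _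
  have hρB : BdT r (M * (1 + ∑ k ∈ idx d N, vB d * Mk k)) ρ := by
    refine (hφ.add (bdT_sum _ _ (fun k => |c k| * Mk k) r fun k _ => (hMk k).smul (c k))).mono ?_
    rw [mul_add, mul_one, Finset.mul_sum]
    refine add_le_add le_rfl (Finset.sum_le_sum fun k _ => ?_)
    rw [← mul_assoc]
    exact mul_le_mul_of_nonneg_right (hck k) (hMk0 k).le
  have hρ0 : ∀ j : MIdx d, (mdeg j : ℝ) ≤ a → mom j ρ = 0 := by
    intro j hj
    have hjN := ha j hj
    rw [hρ, mom_add hφ.1.1 (isTest_sum _ _ hT), mom_sum _ _ hT]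
    have : ∀ k ∈ idx d N, mom j (c k • mderiv k η) = if j = k then - mom k φ else 0 := by
      intro k hk
      rw [mom_smul, hη.mom_mderiv hjN]
      split_ifs
      · have h1 : ((-1:ℝ) ^ mdeg k) * (-1) ^ mdeg k = 1 := by rw [← mul_pow]; simp
        have := (mfact_pos k).ne'
        simp only [hc]
        field_simp
        linear_combination (-1 * mom k φ) * h1
      · simp
    rw [Finset.sum_congr rfl this, Finset.sum_ite_eq, if_pos (mem_idx.2 hjN)]
    ring
  have hA0 : 0 < M * (1 + ∑ k ∈ idx d N, vB d * Mk k) := by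
    have : 0 ≤ ∑ k ∈ idx d N, vB d * Mk k :=
      Finset.sum_nonneg fun k _ => mul_nonneg vB_nonneg (hMk0 k).le
    positivity
  have h1 := ann_bound hf hl hB hA0 hρB hρ0
  convert h1 using 2
  rw [hρ, scTF_add, scTF_sum, hf.1 _ _ (hφ.1.1.scTF x hl)
    (isTest_sum _ _ fun k hk => (hT k hk).scTF x hl),
    distr_sum hf _ _ fun k hk => (hT k hk).scTF x hl, sub_eq_add_neg, ← Finset.sum_neg_distrib]
  congr 1
  refine Finset.sum_congr rfl fun k _ => ?_
  rw [scTF_smul, hf.2.1 _ _ ((hη.1.1.mderiv k).scTF x hl), distr_mderiv hf hη.1.1 x hl]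
  have h1 : ((-1:ℝ) ^ mdeg k) * (-1) ^ mdeg k = 1 := by rw [← mul_pow]; simp
  simp only [hc]
  linear_combination (mom k φ / mfact k * (l ^ mdeg k * distDeriv k f (scTF η x l))) * h1

/-- The small-scale bound of weak homogeneity at a single point. -/
def SmB (f : DFunc d) (r : ℕ) (a : ℝ) (x : Ed d) (lb C : ℝ) : Prop :=
  ∀ l : ℝ, 0 < l → l ≤ lb → ∀ φ ∈ TBAnn d r a, |f (scTF φ x l)| ≤ C * l ^ a

lemma zero_mem_TB (d r : ℕ) : (0 : Ed d → ℝ) ∈ TB d r :=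
  bdT_one_iff.1 ((bdT_zero r).mono zero_le_one)

lemma zero_mem_TBAnn (d r : ℕ) (a : ℝ) : (0 : Ed d → ℝ) ∈ TBAnn d r a :=
  ⟨zero_mem_TB d r, (zero_mem_TB d r).1, (zero_mem_TB d r).2.1, by simp⟩

lemma SmB.nonneg {f : DFunc d} {r : ℕ} {a : ℝ} {x : Ed d} {lb C : ℝ} (hlb : 0 < lb)
    (h : SmB f r a x lb C) : 0 ≤ C := by
  have h1 := (abs_nonneg _).trans (h lb hlb le_rfl 0 (zero_mem_TBAnn d r a))
  have h2 := Real.rpow_pos_of_pos hlb a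
  exact nonneg_of_mul_nonneg_left h1 h2

/-- Increments of the mollified derivatives. -/
lemma incr {N : ℕ} {η : Ed d → ℝ} (hη : Moll N η) (r : ℕ) (a : ℝ)
    (ha : ∀ k : MIdx d, (mdeg k : ℝ) ≤ a → mdeg k ≤ N) :
    ∃ A : ℝ, 0 < A ∧ ∀ f : DFunc d, IsDistribution f → ∀ (x : Ed d) (lb C : ℝ), 0 < lb →
      SmB f r a x lb C → ∀ k ∈ idx d N, ∀ l, 0 < l → l ≤ lb → ∀ t, 1/2 ≤ t → t ≤ 1 →
      |distDeriv k f (scTF η x (t * l)) - distDeriv k f (scTF η x l)|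
        ≤ A * C * l ^ (a - mdeg k) := by
  obtain ⟨A, hA0, hA⟩ := key_decomp hη r a ha
  choose M hM0 hM using fun k : MIdx d =>
    exists_bdT_mderiv_scTF r hη.1 k (show (0:ℝ) < 1/2 by norm_num)
  have hMk : ∀ k ∈ idx d N, M k ≤ 1 + ∑ k ∈ idx d N, M k := fun k hk => by
    have := Finset.single_le_sum (fun k _ => (hM0 k).le) hk
    linarith
  have hS : 0 < 1 + ∑ k ∈ idx d N, M k := by
    have := Finset.sum_nonneg fun k (_ : k ∈ idx d N) => (hM0 k).le
    linarith
  refine ⟨(1 + ∑ k ∈ idx d N, M k) * A, mul_pos hS hA0, ?_⟩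
  intro f hf x lb C hlb hB k hk l hl hl' t ht ht1
  have ht0 : 0 < t := by linarith
  have hB' := hA f hf x l (C * l ^ a) hl (hB l hl hl') (M k) (hM0 k) _ (hM k t ht ht1)
  have hηt := hη.scTF ht0 ht1
  rw [distr_mderiv hf hηt.1.1 x hl, scTF_scTF] at hB'
  have hsum : ∑ j ∈ idx d N, (mom j (mderiv k (scTF η 0 t)) / mfact j) *
      (l ^ mdeg j * distDeriv j f (scTF η x l)) =
      (-1) ^ mdeg k * (l ^ mdeg k * distDeriv k f (scTF η x l)) := by
    rw [Finset.sum_eq_single_of_mem k hk]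
    · rw [hηt.mom_mderiv (mem_idx.1 hk), if_pos rfl, mul_div_cancel_right₀ _ (mfact_pos k).ne']
    · intro j hj hjk
      rw [hηt.mom_mderiv (mem_idx.1 hj), if_neg hjk]
      simp
  rw [hsum, mul_assoc, ← mul_sub, ← mul_sub, abs_mul, abs_mul, abs_pow, abs_neg, abs_one, one_pow,
    one_mul, abs_of_pos (pow_pos hl _)] at hB'
  have hC := hB.nonneg hlb
  have hla : 0 ≤ l ^ a := Real.rpow_nonneg hl.le _
  rw [Real.rpow_sub hl, Real.rpow_natCast, ← mul_div_assoc, le_div_iff₀ (pow_pos hl _), mul_comm]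
  refine hB'.trans ?_
  rw [mul_assoc _ C]
  gcongr
  exact hMk k hk

lemma floor_idx {a : ℝ} (k : MIdx d) : (mdeg k : ℝ) ≤ a → mdeg k ≤ ⌊a⌋₊ :=
  fun h => Nat.le_floor h

lemma Moll.good {a : ℝ} {η : Ed d → ℝ} (hη : Moll ⌊a⌋₊ η) : GoodEta a η := by
  refine ⟨hη.1.1, ?_, fun k h1 h2 => hη.2.2 k h1 (floor_idx k h2.le)⟩
  have := hη.2.1
  simpa [mom, mpow] using this

/-- Existence of pointwise derivatives. -/
lemma exists_ptDeriv {f : DFunc d} (hf : IsDistribution f) {r : ℕ} {a : ℝ} {x : Ed d} {C : ℝ}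
    (h : SmB f r a x 1 C) (k : MIdx d) (hk : (mdeg k : ℝ) < a) :
    ∃ v, HasPtDeriv f a k x v := by
  obtain ⟨η, hη⟩ := exists_eta d ⌊a⌋₊
  change Moll ⌊a⌋₊ η at hη
  have hC := h.nonneg one_pos
  obtain ⟨A, hA0, hA⟩ := incr hη r a floor_idx
  have hinc := hA f hf x 1 C one_pos h
  have hkN : k ∈ idx d ⌊a⌋₊ := mem_idx.2 (floor_idx k hk.le)
  obtain ⟨v, hv⟩ := exists_limit (g := fun l => distDeriv k f (scTF η x l))
    (sub_pos.2 hk) (by positivity) one_pos (hinc k hkN)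
  refine ⟨v, fun ζ₀ hζ₀ => ?_⟩
  obtain ⟨R, hR1, hR⟩ := hζ₀.1.exists_ball
  have hR0 : 0 < R := by linarith
  set ζ := scTF ζ₀ 0 R⁻¹ with hζ
  have hζT : TestIn (closedBall 0 1) ζ := by
    have := testIn_scTF hR 0 (inv_pos.2 hR0)
    rwa [inv_mul_cancel₀ hR0.ne'] at this
  have hζ1 : mom 0 ζ = 1 := by
    rw [hζ, mom_scTF _ (inv_pos.2 hR0), mdeg_zero]
    have := hζ₀.2.1
    simpa [mom, mpow] using this
  have hζm : ∀ m : MIdx d, 1 ≤ mdeg m → (mdeg m : ℝ) < a → mom m ζ = 0 := by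
    intro m h1 h2
    have h3 : mom m ζ₀ = 0 := hζ₀.2.2 m h1 h2
    rw [hζ, mom_scTF _ (inv_pos.2 hR0), h3, mul_zero]
  -- it suffices to treat `ζ`
  suffices hmain : Tendsto (fun l : ℝ => distDeriv k f (scTF ζ x l)) (𝓝[>] 0) (𝓝 v) by
    have h1 : Tendsto (fun l : ℝ => R * l) (𝓝[>] 0) (𝓝[>] 0) := by
      refine tendsto_nhdsWithin_iff.2 ⟨?_, ?_⟩
      · have : Tendsto (fun l : ℝ => R * l) (𝓝 0) (𝓝 (R * 0)) :=
          (continuous_const.mul continuous_id).tendsto 0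
        rw [mul_zero] at this
        exact this.mono_left nhdsWithin_le_nhds
      · filter_upwards [self_mem_nhdsWithin] with l hl
        exact mul_pos hR0 hl
    have h2 := hmain.comp h1
    refine h2.congr fun l => ?_
    simp only [Function.comp, hζ, scTF_scTF]
    rw [inv_mul_cancel_left₀ hR0.ne']
  obtain ⟨A₂, hA₂0, hA₂⟩ := key_decomp hη r a floor_idx
  obtain ⟨M, hM0, hM⟩ := exists_bdT r (hζT.mderiv k)
  -- the cross terms
  have hcross : ∀ j ∈ (idx d ⌊a⌋₊).erase k, Tendsto (fun l : ℝ =>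
      (mom j (mderiv k ζ) / mfact j) * (l ^ mdeg j * distDeriv j f (scTF η x l)) / l ^ mdeg k)
      (𝓝[>] 0) (𝓝 0) := by
    intro j hj
    have hjk := Finset.ne_of_mem_erase hj
    have hjN := Finset.mem_of_mem_erase hj
    by_cases hcase : ∀ m : MIdx d, 1 ≤ mdeg m → mdeg m + mdeg k = mdeg j → (mdeg m : ℝ) < a
    · have : mom j (mderiv k ζ) = 0 :=
        mom_mderiv_of_ne hζT.1 hjk fun m h1 h2 => hζm m h1 (hcase m h1 h2)
      simp [this]
    · push Not at hcase
      obtain ⟨m, hm1, hm2, hm3⟩ := hcase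
      have hja : (mdeg j : ℝ) ≤ a := by
        have h1 := mem_idx.1 hjN
        have h2 : (0:ℝ) ≤ a := le_trans (Nat.cast_nonneg _) hk.le
        exact (Nat.cast_le.2 h1).trans (Nat.floor_le h2)
      have hmj : mdeg m ≤ mdeg j := by omega
      have hmj' : (mdeg m : ℝ) ≤ mdeg j := by exact_mod_cast hmj
      have hjm : (mdeg j : ℝ) = mdeg m := by linarith
      have hjm' : mdeg j = mdeg m := by exact_mod_cast hjm
      have hk0 : mdeg k = 0 := by omega
      have haj : a - mdeg j = 0 := by linarith
      have hlog := log_growth (g := fun l => distDeriv j f (scTF η x l)) (D := A * C)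
        (by positivity) (fun l hl hl1 t ht ht1 => by
          have := hinc j hjN l hl hl1 t ht ht1
          rwa [haj, Real.rpow_zero, mul_one] at this) (n := mdeg j) (by omega)
      have := hlog.const_mul (mom j (mderiv k ζ) / mfact j)
      rw [mul_zero] at this
      simpa [hk0] using this
  have hcs := tendsto_finsetSum _ hcross
  rw [Finset.sum_const_zero] at hcs
  -- the error term
  have herr : Tendsto (fun l : ℝ => M * A₂ * C * l ^ (a - mdeg k)) (𝓝[>] 0) (𝓝 0) := by
    have h1 : Tendsto (fun l : ℝ => l ^ (a - mdeg k)) (𝓝 0) (𝓝 0) := by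
      have := (Real.continuousAt_rpow_const 0 (a - mdeg k) (Or.inr (sub_pos.2 hk).le)).tendsto
      rwa [Real.zero_rpow (sub_pos.2 hk).ne'] at this
    have h2 := h1.const_mul (M * A₂ * C)
    rw [mul_zero] at h2
    exact h2.mono_left nhdsWithin_le_nhds
  set s : ℝ := (-1) ^ mdeg k with hs
  have hss : s * s = 1 := by rw [hs, ← mul_pow]; simp
  have hsabs : |s| = 1 := by rw [hs]; simp
  have hrem : Tendsto (fun l : ℝ => distDeriv k f (scTF ζ x l) - distDeriv k f (scTF η x l) -
      s * ∑ j ∈ (idx d ⌊a⌋₊).erase k, (mom j (mderiv k ζ) / mfact j) *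
        (l ^ mdeg j * distDeriv j f (scTF η x l)) / l ^ mdeg k) (𝓝[>] 0) (𝓝 0) := by
    refine squeeze_zero_norm' ?_ herr
    filter_upwards [Ioc_mem_nhdsGT (zero_lt_one' ℝ)] with l hl
    have hlk : 0 < l ^ mdeg k := pow_pos hl.1 _
    have h1 := hA₂ f hf x l (C * l ^ a) hl.1 (h l hl.1 hl.2) M hM0 _ hM
    rw [distr_mderiv hf hζT.1 x hl.1, ← Finset.add_sum_erase _ _ hkN, mom_mderiv_self hζT.1, hζ1,
      mul_one, mul_div_cancel_right₀ _ (mfact_pos k).ne', ← hs] at h1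
    rw [Real.norm_eq_abs, Real.rpow_sub hl.1, Real.rpow_natCast, ← mul_div_assoc,
      le_div_iff₀ hlk, mul_assoc _ C]
    refine le_trans (le_of_eq ?_) h1
    rw [← abs_of_pos hlk, ← abs_mul, abs_of_pos hlk, ← one_mul |_ * _|, ← hsabs, ← abs_mul,
      ← Finset.sum_div]
    congr 1
    generalize (∑ j ∈ (idx d ⌊a⌋₊).erase k, (mom j (mderiv k ζ) / mfact j) *
        (l ^ mdeg j * distDeriv j f (scTF η x l))) = T
    generalize distDeriv k f (scTF ζ x l) = P
    generalize distDeriv k f (scTF η x l) = Q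
    have hT : T / l ^ mdeg k * l ^ mdeg k = T := div_mul_cancel₀ _ hlk.ne'
    linear_combination (-T) * hss - s * s * hT
  have hfin := (hrem.add (hcs.const_mul s)).add hv
  simp only [mul_zero, add_zero, zero_add] at hfin
  refine hfin.congr fun l => ?_
  ring

lemma le_of_mem_idx {a : ℝ} (ha : 0 ≤ a) {k : MIdx d} (hk : k ∈ idx d ⌊a⌋₊) :
    (mdeg k : ℝ) ≤ a :=
  (Nat.cast_le.2 (mem_idx.1 hk)).trans (Nat.floor_le ha)

lemma taylor_eq {a : ℝ} (c : MIdx d → ℝ) (x : Ed d) (φ : Ed d → ℝ) {l : ℝ}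
    (hl : 0 < l) : taylorF a c x (scTF φ x l) = ∑ k ∈ idx d ⌊a⌋₊,
      if (mdeg k : ℝ) < a then (mom k φ / mfact k) * (l ^ mdeg k * c k) else 0 := by
  have h1 : {k : MIdx d | (mdeg k : ℝ) < a} =
      ↑((idx d ⌊a⌋₊).filter fun k => (mdeg k : ℝ) < a) := by
    ext k
    simp only [Finset.coe_filter, Set.mem_ofPred_eq]
    exact ⟨fun h => ⟨mem_idx.2 (floor_idx k h.le), h⟩, fun h => h.2⟩
  rw [taylorF, h1, finsum_mem_coe_finset, Finset.sum_filter]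
  refine Finset.sum_congr rfl fun k _ => ?_
  rw [integral_scTF_mpow φ x hl]
  split_ifs
  · ring
  · rfl

lemma distDeriv_tb_bound {f : DFunc d} (hf : IsDistribution f) {r : ℕ} {x : Ed d} {l B : ℝ}
    (hl : 0 < l) (k : MIdx d)
    (hB : ∀ φ ∈ TB d r, |distDeriv k f (scTF φ x l)| ≤ B) {M : ℝ} (hM : 0 < M) {φ : Ed d → ℝ}
    (h : BdT r M φ) : |distDeriv k f (scTF φ x l)| ≤ M * B := by
  have h1 := hB _ (bdT_scale hM h)
  have h2 : distDeriv k f (scTF (M⁻¹ • φ) x l) = M⁻¹ * distDeriv k f (scTF φ x l) := by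
    rw [scTF_smul, distDeriv, distDeriv, mderiv_smul,
      hf.2.1 _ _ ((h.1.1.scTF x hl).mderiv k)]
    ring
  rw [h2, abs_mul, abs_of_pos (inv_pos.2 hM), inv_mul_le_iff₀ hM] at h1
  exact h1

/-- Core homogeneity bound. -/
lemma core_bound (d : ℕ) {a : ℝ} (ha : 0 ≤ a) (r : ℕ) :
    ∃ c : ℝ, 0 ≤ c ∧ ∀ f : DFunc d, IsDistribution f → ∀ (x : Ed d) (lb C C₂ : ℝ), 0 < lb →
      0 ≤ C₂ → SmB f r a x lb C →
      (∀ k : MIdx d, (mdeg k : ℝ) = a → ∀ l : ℝ, 0 < l → l ≤ lb → ∀ φ ∈ TB d r,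
        |distDeriv k f (scTF φ x l)| ≤ C₂ * l ^ (0:ℝ)) →
      ∀ Dv : MIdx d → ℝ, (∀ k, (mdeg k : ℝ) < a → HasPtDeriv f a k x (Dv k)) →
      ∀ l : ℝ, 0 < l → l ≤ lb → ∀ φ ∈ TB d r,
        |f (scTF φ x l) - taylorF a Dv x (scTF φ x l)| ≤ c * (C + C₂) * l ^ a := by
  obtain ⟨η, hη⟩ := exists_eta d ⌊a⌋₊
  change Moll ⌊a⌋₊ η at hη
  obtain ⟨A, hA0, hA⟩ := incr hη r a floor_idx
  obtain ⟨A₂, hA₂0, hA₂⟩ := key_decomp hη r a floor_idx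
  obtain ⟨M, hM0, hM⟩ := exists_bdT r hη.1
  set E : MIdx d → ℝ := fun k => A * (1 - (1/2 : ℝ) ^ (a - mdeg k))⁻¹ + M with hE
  have hS0 : ∀ k ∈ idx d ⌊a⌋₊, 0 ≤ A * (1 - (1/2 : ℝ) ^ (a - mdeg k))⁻¹ := by
    intro k hk
    have := le_of_mem_idx ha hk
    have h1 : (1/2 : ℝ) ^ (a - mdeg k) ≤ 1 :=
      Real.rpow_le_one (by norm_num) (by norm_num) (by linarith)
    exact mul_nonneg hA0.le (inv_nonneg.2 (by linarith))
  have hE0 : ∀ k ∈ idx d ⌊a⌋₊, 0 ≤ E k := fun k hk => add_nonneg (hS0 k hk) hM0.le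
  refine ⟨A₂ + ∑ k ∈ idx d ⌊a⌋₊, vB d * E k, ?_, ?_⟩
  · have := Finset.sum_nonneg fun k hk => mul_nonneg (vB_nonneg (d := d)) (hE0 k hk)
    linarith
  intro f hf x lb C C₂ hlb hC₂ hB hB₂ Dv hDv l hl hl' φ hφ
  have hC := hB.nonneg hlb
  have hla : 0 ≤ l ^ a := Real.rpow_nonneg hl.le _
  have hφB : BdT r 1 φ := bdT_one_iff.2 hφ
  have h1 := hA₂ f hf x l (C * l ^ a) hl (hB l hl hl') 1 one_pos φ hφB
  rw [taylor_eq Dv x φ hl]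
  have hterm : ∀ k ∈ idx d ⌊a⌋₊,
      |(mom k φ / mfact k) * (l ^ mdeg k * distDeriv k f (scTF η x l)) -
        (if (mdeg k : ℝ) < a then (mom k φ / mfact k) * (l ^ mdeg k * Dv k) else 0)|
      ≤ vB d * E k * ((C + C₂) * l ^ a) := by
    intro k hk
    have hlk : 0 < l ^ mdeg k := pow_pos hl _
    have hm : |mom k φ / mfact k| ≤ vB d := by
      rw [abs_div, abs_of_pos (mfact_pos k)]
      refine (div_le_self (abs_nonneg _) (one_le_mfact k)).trans ?_
      simpa using hφB.abs_mom_le k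
    rw [mul_assoc]
    split_ifs with hka
    · rw [← mul_sub, ← mul_sub, abs_mul, abs_mul, abs_of_pos hlk]
      refine mul_le_mul hm ?_ (by positivity) vB_nonneg
      have h2 := limit_bound (g := fun l => distDeriv k f (scTF η x l)) (sub_pos.2 hka)
        (by positivity) (hA f hf x lb C hlb hB k hk) (hDv k hka η hη.good) hl hl'
      rw [Real.rpow_sub hl, Real.rpow_natCast, ← mul_div_assoc, le_div_iff₀ hlk] at h2
      rw [mul_comm]
      refine h2.trans ?_
      rw [← mul_assoc]
      refine mul_le_mul_of_nonneg_right ?_ hla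
      have h3 := hS0 k hk
      rw [hE]
      have h4 : 0 ≤ A * (1 - (1/2 : ℝ) ^ (a - mdeg k))⁻¹ * C₂ := mul_nonneg h3 hC₂
      have h5 : 0 ≤ M * (C + C₂) := by positivity
      linarith
    · have hka' : (mdeg k : ℝ) = a := le_antisymm (le_of_mem_idx ha hk) (not_lt.1 hka)
      have h2 := distDeriv_tb_bound hf hl k (hB₂ k hka' l hl hl') hM0 hM
      rw [sub_zero, abs_mul, abs_mul, abs_of_pos hlk]
      refine mul_le_mul hm ?_ (by positivity) vB_nonneg
      have hlka : l ^ mdeg k = l ^ a := by rw [← hka', Real.rpow_natCast]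
      rw [hlka, mul_comm, ← mul_assoc]
      refine mul_le_mul_of_nonneg_right ?_ hla
      rw [Real.rpow_zero, mul_one] at h2
      refine h2.trans ?_
      rw [hE]
      have h3 := hS0 k hk
      have h4 : 0 ≤ A * (1 - (1/2 : ℝ) ^ (a - mdeg k))⁻¹ * (C + C₂) := mul_nonneg h3 (by positivity)
      have h5 : 0 ≤ M * C := by positivity
      linarith
  have hsum := (Finset.abs_sum_le_sum_abs _ _).trans (Finset.sum_le_sum hterm)
  rw [Finset.sum_sub_distrib] at hsum
  refine (abs_sub_le _ _ _).trans ((add_le_add h1 hsum).trans ?_)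
  rw [← Finset.sum_mul, one_mul]
  have h9 := mul_nonneg hA₂0.le (mul_nonneg hC₂ hla)
  generalize (∑ k ∈ idx d ⌊a⌋₊, vB d * E k) = S
  linarith

/-- Bound on the pointwise derivatives. -/
lemma deriv_bound (d : ℕ) (a : ℝ) (r : ℕ) {lb : ℝ} (hlb : 0 < lb) :
    ∃ c : ℝ, ∀ f : DFunc d, IsDistribution f → ∀ (x : Ed d) (C : ℝ),
      SmB f r a x lb C → (∀ ψ ∈ TB d r, |f (scTF ψ x 1)| ≤ C) →
      ∀ k : MIdx d, (mdeg k : ℝ) < a → ∀ v, HasPtDeriv f a k x v → |v| ≤ c * C := by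
  obtain ⟨η, hη⟩ := exists_eta d ⌊a⌋₊
  change Moll ⌊a⌋₊ η at hη
  obtain ⟨A, hA0, hA⟩ := incr hη r a floor_idx
  set L := min lb 1 with hL
  have hL0 : 0 < L := lt_min hlb one_pos
  have hL1 : L ≤ 1 := min_le_right _ _
  have hLlb : L ≤ lb := min_le_left _ _
  choose M hM0 hM using fun k : MIdx d => exists_bdT_mderiv_scTF r hη.1 k hL0
  set E : MIdx d → ℝ := fun k => M k + |A * (1 - (1/2 : ℝ) ^ (a - mdeg k))⁻¹| with hE
  refine ⟨∑ k ∈ idx d ⌊a⌋₊, E k, ?_⟩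
  intro f hf x C hB hB1 k hk v hv
  have hC := hB.nonneg hlb
  have hkN : k ∈ idx d ⌊a⌋₊ := mem_idx.2 (floor_idx k hk.le)
  have h1 := limit_bound (g := fun l => distDeriv k f (scTF η x l)) (sub_pos.2 hk)
    (by positivity) (hA f hf x lb C hlb hB k hkN) (hv η hη.good) hL0 hLlb
  have h2 := tb_bound hf one_pos hB1 (hM0 k) (hM k L le_rfl hL1)
  rw [distr_mderiv hf (hη.scTF hL0 hL1).1.1 x one_pos, scTF_scTF, mul_one, one_pow, mul_one,
    abs_mul, abs_pow, abs_neg, abs_one, one_pow, one_mul] at h2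
  have h3 : L ^ (a - mdeg k) ≤ 1 := Real.rpow_le_one hL0.le hL1 (sub_pos.2 hk).le
  have h3' : 0 ≤ L ^ (a - mdeg k) := Real.rpow_nonneg hL0.le _
  have h4 : A * C * (1 - (1/2 : ℝ) ^ (a - mdeg k))⁻¹ * L ^ (a - mdeg k) ≤
      |A * (1 - (1/2 : ℝ) ^ (a - mdeg k))⁻¹| * C := by
    calc _ = (A * (1 - (1/2 : ℝ) ^ (a - mdeg k))⁻¹) * C * L ^ (a - mdeg k) := by ring
      _ ≤ |A * (1 - (1/2 : ℝ) ^ (a - mdeg k))⁻¹| * C * L ^ (a - mdeg k) := by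
        gcongr; exact le_abs_self _
      _ ≤ _ := mul_le_of_le_one_right (by positivity) h3
  have h5 : |v| ≤ E k * C := by
    have := abs_sub_abs_le_abs_sub v (distDeriv k f (scTF η x L))
    rw [abs_sub_comm] at this
    simp only [hE, add_mul]
    linarith
  refine h5.trans (mul_le_mul_of_nonneg_right ?_ hC)
  exact Finset.single_le_sum (f := E) (fun k _ => add_nonneg (hM0 k).le (abs_nonneg _)) hkN

lemma taylor_neg {a : ℝ} (ha : a < 0) (c : MIdx d → ℝ) (x : Ed d) (φ : Ed d → ℝ) :
    taylorF a c x φ = 0 := by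
  have : {k : MIdx d | (mdeg k : ℝ) < a} = ∅ := by
    ext k
    simp only [Set.mem_ofPred_eq, Set.mem_empty_iff_false, iff_false, not_lt]
    exact ha.le.trans (Nat.cast_nonneg _)
  rw [taylorF, this, finsum_mem_empty]

lemma tb_sub_tbann {a : ℝ} (ha : a < 0) (r : ℕ) : TB d r ⊆ TBAnn d r a := by
  intro φ hφ
  refine ⟨hφ, hφ.1, hφ.2.1, fun k hk => ?_⟩
  have : (0:ℝ) ≤ mdeg k := Nat.cast_nonneg _
  linarith

lemma exists_common {F : GermF d} {a : ℝ} {r : ℕ}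
    (hH : ∀ k : MIdx d, (mdeg k : ℝ) = a → Homog (fun x => distDeriv k (F x)) 0 r)
    (K : Set (Ed d)) (hK : IsCompact K) (lb : ℝ) (hlb : 1 ≤ lb) :
    ∃ C₂, ∀ k : MIdx d, (mdeg k : ℝ) = a → HomB (fun x => distDeriv k (F x)) 0 r K lb C₂ := by
  have : ∀ k : MIdx d, ∃ C, (mdeg k : ℝ) = a → HomB (fun x => distDeriv k (F x)) 0 r K lb C := by
    intro k
    by_cases hk : (mdeg k : ℝ) = a
    · obtain ⟨C, hC⟩ := hH k hk K hK lb hlb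
      exact ⟨C, fun _ => hC⟩
    · exact ⟨0, fun h => absurd h hk⟩
  choose C hC using this
  refine ⟨∑ k ∈ idx d ⌊a⌋₊, |C k|, fun k hk x hx l hl hl' φ hφ => ?_⟩
  refine (hC k hk x hx l hl hl' φ hφ).trans ?_
  refine mul_le_mul_of_nonneg_right ((le_abs_self _).trans ?_) (Real.rpow_nonneg hl.le _)
  exact Finset.single_le_sum (f := fun k => |C k|) (fun k _ => abs_nonneg _)
    (mem_idx.2 (floor_idx k hk.le))

/-- If there is no multi-index of degree `a`, then `d = 0` and the bound is trivial. -/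
lemma smB_of_no_idx {f : DFunc d} (hf : IsDistribution f) {r n : ℕ} {a : ℝ} (ha : 0 ≤ a)
    (hn : a = n) (hex : ¬ ∃ k : MIdx d, (mdeg k : ℝ) = a) {x : Ed d} {lb : ℝ} :
    SmB f r a x lb 0 := by
  have hd : d = 0 := by
    by_contra hd
    refine hex ⟨Pi.single ⟨0, Nat.pos_of_ne_zero hd⟩ n, ?_⟩
    rw [hn, mdeg]
    simp
  subst hd
  intro l hl hl' φ hφ
  obtain ⟨η, -, hη1, -⟩ := exists_eta 0 0
  have h0 : mom 0 φ = 0 := hφ.2.2.2 0 (by simpa [mdeg] using ha)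
  have hη : η 0 * φ 0 = 0 := by
    have e : (η 0) • φ = (φ 0) • η := by
      funext z
      have hz : z = 0 := Subsingleton.elim _ _
      subst hz
      simp [mul_comm]
    have e2 := congrArg (mom 0) e
    rw [mom_smul, mom_smul, h0, hη1] at e2
    have e3 : φ 0 = 0 := by linarith
    rw [e3, mul_zero]
  have hη0 : η 0 ≠ 0 := by
    intro h
    have : η = 0 := by
      funext z
      have hz : z = 0 := Subsingleton.elim _ _
      subst hz
      exact h
    rw [this] at hη1
    simp [mom] at hη1
  have hφ0 : φ = 0 := by
    funext z
    have hz : z = 0 := Subsingleton.elim _ _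
    subst hz
    exact (mul_eq_zero.1 hη).resolve_left hη0
  have : scTF φ x l = 0 := by
    rw [hφ0]
    funext z
    simp [scTF]
  rw [this, distr_zero hf]
  simp

/-- Theorem 4.8, positive renormalisation of weakly homogeneous germs:
for a weakly `ᾱ`-homogeneous germ `F` of order `r`, all pointwise derivatives
`D^k F_x(x)` with `|k| < ᾱ` exist, with `sup_{x∈K} |D^k F_x(x)|` bounded by a constant
(depending only on `ᾱ, λ̄, r, d`) times the weak homogeneity seminorm.  Moreover, for
`G_x := F_x - Σ_{|k|<ᾱ} D^k F_x(x)(·-x)^k/k!`: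
(1) if `ᾱ ∉ ℕ₀`, `G` is `ᾱ`-homogeneous with seminorm (at every order `r'`) controlled by
the weak seminorm of `F`, the constant depending only on `ᾱ, r', d`;
(2) if `ᾱ ∈ ℕ₀` and each germ `D^k F`, `|k| = ᾱ`, is `0`-homogeneous, the same holds with
the `0`-homogeneity seminorms of the `D^k F` added on the right-hand side. -/
theorem positive_renormalisation_homogeneous
    (d : ℕ) (abar : ℝ) (r : ℕ) :
    -- existence of the pointwise derivatives
    (∀ F : GermF d, IsGerm F → WHomog F abar r →
      ∀ x : Ed d, ∀ k : MIdx d, (mdeg k : ℝ) < abar →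
        ∃ v : ℝ, HasPtDeriv (F x) abar k x v) ∧
    -- uniform bound on the pointwise derivatives
    (∀ lb : ℝ, 0 < lb → ∃ cst : ℝ,
      ∀ F : GermF d, IsGerm F → WHomog F abar r →
      ∀ Dv : Ed d → MIdx d → ℝ,
        (∀ x k, (mdeg k : ℝ) < abar → HasPtDeriv (F x) abar k x (Dv x k)) →
      ∀ K : Set (Ed d), IsCompact K → ∀ C : ℝ, WHomB F abar r K lb C →
        ∀ x ∈ K, ∀ k : MIdx d, (mdeg k : ℝ) < abar → |Dv x k| ≤ cst * C) ∧
    -- (1): the non-integer case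
    ((∀ n : ℕ, abar ≠ (n : ℝ)) →
      ∀ r' : ℕ, ∃ cst' : ℝ,
        ∀ F : GermF d, IsGerm F → WHomog F abar r →
        ∀ Dv : Ed d → MIdx d → ℝ,
          (∀ x k, (mdeg k : ℝ) < abar → HasPtDeriv (F x) abar k x (Dv x k)) →
        Homog (fun x φ => F x φ - taylorF abar (Dv x) x φ) abar r ∧
        ∀ K : Set (Ed d), IsCompact K → ∀ lb : ℝ, 0 < lb → ∀ C : ℝ,
          WHomB F abar r' K lb C →
          HomB (fun x φ => F x φ - taylorF abar (Dv x) x φ) abar r' K lb (cst' * C)) ∧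
    -- (2): the integer case
    ((∃ n : ℕ, abar = (n : ℝ)) →
      ∀ r' : ℕ, ∃ cst' : ℝ,
        ∀ F : GermF d, IsGerm F → WHomog F abar r →
        (∀ k : MIdx d, (mdeg k : ℝ) = abar → Homog (fun x => distDeriv k (F x)) 0 r) →
        ∀ Dv : Ed d → MIdx d → ℝ,
          (∀ x k, (mdeg k : ℝ) < abar → HasPtDeriv (F x) abar k x (Dv x k)) →
        Homog (fun x φ => F x φ - taylorF abar (Dv x) x φ) abar r ∧
        ∀ K : Set (Ed d), IsCompact K → ∀ lb : ℝ, 0 < lb → ∀ C C₂ : ℝ,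
          WHomB F abar r' K lb C →
          (∀ k : MIdx d, (mdeg k : ℝ) = abar →
            HomB (fun x => distDeriv k (F x)) 0 r' K lb C₂) →
          HomB (fun x φ => F x φ - taylorF abar (Dv x) x φ) abar r' K lb
            (cst' * (C + C₂))) := by
  refine ⟨?_, ?_, ?_, ?_⟩
  · intro F hF hW x k hk
    obtain ⟨C, hC⟩ := hW {x} isCompact_singleton 1 le_rfl
    exact exists_ptDeriv (hF.1 x) (fun l hl hl' φ hφ => hC.1 x rfl l hl hl' φ hφ) k hk
  · intro lb hlb
    obtain ⟨c, hc⟩ := deriv_bound d abar r hlb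
    refine ⟨c, fun F hF _ Dv hDv K _ C hC x hx k hk => ?_⟩
    exact hc (F x) (hF.1 x) x C (hC.1 x hx) (hC.2 x hx) k hk _ (hDv x k hk)
  · intro hna r'
    rcases lt_or_ge abar 0 with ha | ha
    · have key : ∀ (F : GermF d) (Dv : Ed d → MIdx d → ℝ) (r : ℕ) (K : Set (Ed d)) (lb C : ℝ),
          WHomB F abar r K lb C →
          HomB (fun x φ => F x φ - taylorF abar (Dv x) x φ) abar r K lb C := by
        intro F Dv r K lb C hC x hx l hl hl' φ hφ
        simp only [taylor_neg ha, sub_zero]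
        exact hC.1 x hx l hl hl' φ (tb_sub_tbann ha r hφ)
      refine ⟨1, fun F hF hW Dv hDv => ⟨?_, ?_⟩⟩
      · intro K hK lb hlb
        obtain ⟨C, hC⟩ := hW K hK lb hlb
        exact ⟨C, key F Dv r K lb C hC⟩
      · intro K hK lb hlb C hC
        rw [one_mul]
        exact key F Dv r' K lb C hC
    · have key : ∀ r : ℕ, ∃ c : ℝ, ∀ F : GermF d, IsGerm F → ∀ Dv : Ed d → MIdx d → ℝ,
          (∀ x k, (mdeg k : ℝ) < abar → HasPtDeriv (F x) abar k x (Dv x k)) →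
          ∀ K : Set (Ed d), ∀ lb : ℝ, 0 < lb → ∀ C : ℝ, WHomB F abar r K lb C →
          HomB (fun x φ => F x φ - taylorF abar (Dv x) x φ) abar r K lb (c * C) := by
        intro r
        obtain ⟨c, hc0, hc⟩ := core_bound d ha r
        refine ⟨c, fun F hF Dv hDv K lb hlb C hC x hx l hl hl' φ hφ => ?_⟩
        have := hc (F x) (hF.1 x) x lb C 0 hlb le_rfl (hC.1 x hx)
          (fun k hk => absurd hk.symm (hna _)) (Dv x) (hDv x) l hl hl' φ hφ
        rwa [add_zero] at this
      obtain ⟨c, hc⟩ := key r'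
      obtain ⟨c₀, hc₀⟩ := key r
      refine ⟨c, fun F hF hW Dv hDv => ⟨?_, ?_⟩⟩
      · intro K hK lb hlb
        obtain ⟨C, hC⟩ := hW K hK lb hlb
        exact ⟨_, hc₀ F hF Dv hDv K lb (by linarith) C hC⟩
      · intro K hK lb hlb C hC
        exact hc F hF Dv hDv K lb hlb C hC
  · rintro ⟨n, hn⟩ r'
    have ha : 0 ≤ abar := by rw [hn]; exact Nat.cast_nonneg _
    have key : ∀ r : ℕ, ∃ c : ℝ, ∀ F : GermF d, IsGerm F → ∀ Dv : Ed d → MIdx d → ℝ,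
        (∀ x k, (mdeg k : ℝ) < abar → HasPtDeriv (F x) abar k x (Dv x k)) →
        ∀ K : Set (Ed d), ∀ lb : ℝ, 0 < lb → ∀ C C₂ : ℝ, WHomB F abar r K lb C →
        (∀ k : MIdx d, (mdeg k : ℝ) = abar → HomB (fun x => distDeriv k (F x)) 0 r K lb C₂) →
        HomB (fun x φ => F x φ - taylorF abar (Dv x) x φ) abar r K lb (c * (C + C₂)) := by
      intro r
      obtain ⟨c, hc0, hc⟩ := core_bound d ha r
      by_cases hex : ∃ k : MIdx d, (mdeg k : ℝ) = abar
      · refine ⟨c, fun F hF Dv hDv K lb hlb C C₂ hC hC2 x hx l hl hl' φ hφ => ?_⟩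
        obtain ⟨k₀, hk₀⟩ := hex
        have hC₂0 : 0 ≤ C₂ := by
          have := (abs_nonneg _).trans (hC2 k₀ hk₀ x hx lb hlb le_rfl 0 (zero_mem_TB d r))
          rwa [Real.rpow_zero, mul_one] at this
        exact hc (F x) (hF.1 x) x lb C C₂ hlb hC₂0 (hC.1 x hx)
          (fun k hk l hl hl' φ hφ => hC2 k hk x hx l hl hl' φ hφ) (Dv x) (hDv x) l hl hl' φ hφ
      · refine ⟨0, fun F hF Dv hDv K lb hlb C C₂ hC hC2 x hx l hl hl' φ hφ => ?_⟩
        have := hc (F x) (hF.1 x) x lb 0 0 hlb le_rfl (smB_of_no_idx (hF.1 x) ha hn hex)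
          (fun k hk => absurd ⟨k, hk⟩ hex) (Dv x) (hDv x) l hl hl' φ hφ
        simpa using this
    obtain ⟨c, hc⟩ := key r'
    obtain ⟨c₀, hc₀⟩ := key r
    refine ⟨c, fun F hF hW hH Dv hDv => ⟨?_, ?_⟩⟩
    · intro K hK lb hlb
      obtain ⟨C, hC⟩ := hW K hK lb hlb
      obtain ⟨C₂, hC₂⟩ := exists_common hH K hK lb hlb
      exact ⟨_, hc₀ F hF Dv hDv K lb (by linarith) C C₂ hC hC₂⟩
    · intro K hK lb hlb C C₂ hC hC₂
      exact hc F hF Dv hDv K lb hlb C C₂ hC hC₂
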